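/- Let n ≥ 0, let V be a finite-dimensional real vector space with a nondegenerate bilinear form Q that is symmetric if n is even and alternating if n is odd, and let (I₁,N₁) be an ℝ-split polarized mixed Hodge structure of weight n on (V,Q), with primitive Hodge–Deligne numbers j^{p,q} = dim_ℂ P₁^{p,q}. Suppose that for each k ≥ 0 a function f_k : ℤ×ℤ → ℤ_{≥0} is given satisfying the Hodge diamond conditions for weight n+k and Hodge numbers (j^{p,n+k−p})_p, namely: (a) Σ_q f_k(p,q) = j^{p,n+k−p} for all p; (b) f_k(p,q) = f_k(q,p) = f_k(n+k−q, n+k−p) for all p,q; (c) f_k(p−1,q−1) ≤ f_k(p,q) whenever p+q ≤ n+k. Then there exists a nilpotent N' ∈ End(V) with Q(N'u,v)+Q(u,N'v) = 0, commuting with N₁ and preserving each subspace N₁^a(P_{n+k}), and an ℝ-split polarized mixed Hodge structure (I₂, N₁+N') of weight n on (V,Q) whose Hodge diamond is (p,q) ↦ Σ_{k ≥ 0} Σ_{0 ≤ a ≤ k} f_k(p+a, q+a); moreover N' can be chosen so that for each k the pair induced on (P_{n+k}, Q^{N₁}_k) is an ℝ-split PMHS of weight n+k with Hodge diamond f_k.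 -/

import Mathlib

/-- `(I, N)` is an ℝ-split polarized mixed Hodge structure of weight `n` on the
subspace `S` of the "complexified" space `W`, relative to the real structure
(conjugation) `σ` and the bilinear form `Q`. -/
def IsRSplitPMHSOn {W : Type*} [AddCommGroup W] [Module ℂ W]
    (n : ℤ) (S : Submodule ℂ W)
    (σ : W →ₛₗ[starRingEnd ℂ] W)
    (Q : W →ₗ[ℂ] W →ₗ[ℂ] ℂ)
    (I : ℤ → ℤ → Submodule ℂ W) (N : W →ₗ[ℂ] W) : Prop :=
  (∃ m : ℕ, ∀ v ∈ S, (N ^ m) v = 0) ∧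
  (∀ u ∈ S, ∀ v ∈ S, Q (N u) v + Q u (N v) = 0) ∧
  (∀ v ∈ S, N v ∈ S) ∧
  (∀ v ∈ S, σ v ∈ S) ∧
  (∀ v ∈ S, N (σ v) = σ (N v)) ∧
  (∀ p q : ℤ, I p q ≤ S) ∧
  iSupIndep (fun pq : ℤ × ℤ => I pq.1 pq.2) ∧
  (⨆ pq : ℤ × ℤ, I pq.1 pq.2) = S ∧
  (∀ p q : ℤ, ∀ u ∈ I p q, σ u ∈ I q p) ∧
  (∀ p q : ℤ, ∀ u ∈ I p q, N u ∈ I (p - 1) (q - 1)) ∧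
  (∀ p q r s : ℤ, p + r ≠ n ∨ q + s ≠ n →
      ∀ u ∈ I p q, ∀ v ∈ I r s, Q u v = 0) ∧
  (∀ k : ℕ, ∀ p q : ℤ, p + q = n + k →
      (∀ u ∈ I p q, (N ^ k) u = 0 → u = 0) ∧
      (∀ v ∈ I (p - k) (q - k), ∃ u ∈ I p q, (N ^ k) u = v)) ∧
  (∀ k : ℕ, ∀ p q : ℤ, p + q = n + k → ∀ u ∈ I p q, (N ^ (k + 1)) u = 0 → u ≠ 0 →
      ∃ r : ℝ, 0 < r ∧ Complex.I ^ (p - q) * Q u ((N ^ k) (σ u)) = (r : ℂ))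

/-- `(I, N)` is an ℝ-split polarized mixed Hodge structure of weight `n` on all of `W`. -/
def IsRSplitPMHS {W : Type*} [AddCommGroup W] [Module ℂ W]
    (n : ℤ) (σ : W →ₛₗ[starRingEnd ℂ] W)
    (Q : W →ₗ[ℂ] W →ₗ[ℂ] ℂ)
    (I : ℤ → ℤ → Submodule ℂ W) (N : W →ₗ[ℂ] W) : Prop :=
  IsRSplitPMHSOn n ⊤ σ Q I N

/-- The real points (σ-fixed vectors) of a conjugation-stable complex subspace `S`. -/
def realIn {W : Type*} [AddCommGroup W] [Module ℂ W]
    (σ : W →ₛₗ[starRingEnd ℂ] W) (S : Submodule ℂ W) : Submodule ℝ W where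
  carrier := {x | x ∈ S ∧ σ x = x}
  add_mem' := by
    rintro a b ⟨haS, haσ⟩ ⟨hbS, hbσ⟩
    exact ⟨S.add_mem haS hbS, by rw [map_add, haσ, hbσ]⟩
  zero_mem' := ⟨S.zero_mem, by simp⟩
  smul_mem' := by
    rintro r x ⟨hxS, hxσ⟩
    constructor
    · have h : r • x = (r : ℂ) • x := (Complex.coe_smul r x).symm
      rw [h]; exact S.smul_mem _ hxS
    · have h : r • x = (r : ℂ) • x := (Complex.coe_smul r x).symm
      rw [h, map_smulₛₗ]
      simp [Complex.conj_ofReal, Complex.coe_smul, hxσ]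

/-- The complex primitive subspace of weight `n + k`:
`⊕_{p+q = n+k} P^{p,q}` where `P^{p,q} = ker(N^{k+1}) ∩ I^{p,q}`. -/
noncomputable def primC {W : Type*} [AddCommGroup W] [Module ℂ W]
    (n : ℤ) (I : ℤ → ℤ → Submodule ℂ W) (N : W →ₗ[ℂ] W) (k : ℕ) :
    Submodule ℂ W :=
  ⨆ p : ℤ, (LinearMap.ker (N ^ (k + 1)) ⊓ I p (n + k - p))

/-- The real primitive subspace `P_{n+k} ⊆ V` of weight `n + k`. -/
noncomputable def realPrim {W : Type*} [AddCommGroup W] [Module ℂ W]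
    (n : ℤ) (σ : W →ₛₗ[starRingEnd ℂ] W) (I : ℤ → ℤ → Submodule ℂ W)
    (N : W →ₗ[ℂ] W) (k : ℕ) : Submodule ℝ W :=
  realIn σ (primC n I N k)


/-- The primitive Hodge–Deligne number `j^{p,q} = dim_ℂ (ker(N^{p+q−n+1}) ∩ I^{p,q})`. -/
noncomputable def primNum {W : Type*} [AddCommGroup W] [Module ℂ W]
    (n : ℤ) (I : ℤ → ℤ → Submodule ℂ W) (N : W →ₗ[ℂ] W) (p q : ℤ) : ℕ :=
  Module.finrank ℂ ↥(LinearMap.ker (N ^ ((p + q - n).toNat + 1)) ⊓ I p q)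

theorem linearIndependent_of_biorthogonal {K V ι : Type*} [Field K] [AddCommGroup V] [Module K V]
    (v : ι → V) (φ : ι → V →ₗ[K] K) (h0 : ∀ i j, j ≠ i → φ i (v j) = 0)
    (h1 : ∀ i, φ i (v i) ≠ 0) : LinearIndependent K v := by
  classical
  rw [linearIndependent_iff']
  intro s g hg i hi
  have h := congrArg (φ i) hg
  rw [map_sum, map_zero, Finset.sum_eq_single_of_mem i hi] at h
  · simpa [h1 i] using h
  · intro j _ hj
    simp [h0 i j hj]

theorem LinearIndependent.iSupIndep_span_image {K V ι κ : Type*} [Field K] [AddCommGroup V]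
    [Module K V] {v : ι → V} (hv : LinearIndependent K v) (τ : ι → κ) :
    iSupIndep (fun j => Submodule.span K (v '' {x | τ x = j})) := by
  rw [iSupIndep_def]
  intro j
  have h : (⨆ (i) (_ : i ≠ j), Submodule.span K (v '' {x | τ x = i})) ≤
      Submodule.span K (v '' {x | τ x ≠ j}) := by
    refine iSup₂_le fun i hi => Submodule.span_mono (Set.image_mono ?_)
    rintro x rfl
    exact hi
  refine Disjoint.mono_right h (hv.disjoint_span_image ?_)
  exact Set.disjoint_left.2 fun x hx hx' => hx' hx

theorem LinearIndependent.finrank_span_image {K V ι : Type*} [Field K] [AddCommGroup V]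
    [Module K V] [Finite ι] {v : ι → V} (hv : LinearIndependent K v) (s : Set ι) :
    Module.finrank K (Submodule.span K (v '' s)) = Nat.card s := by
  have := Fintype.ofFinite s
  rw [Set.image_eq_range, Nat.card_eq_fintype_card]
  exact finrank_span_eq_card (b := fun x : s => v x) (hv.comp _ Subtype.val_injective)

theorem iSupIndep.eq_of_le {K V ι : Type*} [Field K] [AddCommGroup V] [Module K V]
    {A B : ι → Submodule K V} (hB : iSupIndep B) (hAB : ∀ i, A i ≤ B i)
    (hBA : ∀ i, B i ≤ ⨆ j, A j) (i : ι) : A i = B i := by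
  refine le_antisymm (hAB i) fun x hx => ?_
  have hx' : x ∈ A i ⊔ ⨆ (j) (_ : j ≠ i), A j := by
    refine (iSup_le fun j => ?_ : (⨆ j, A j) ≤ _) (hBA i hx)
    by_cases hj : j = i
    · exact hj ▸ le_sup_left
    · exact le_sup_of_le_right (le_iSup₂_of_le j hj le_rfl)
  obtain ⟨y, hy, z, hz, rfl⟩ := Submodule.mem_sup.1 hx'
  have hz' : z ∈ ⨆ (j) (_ : j ≠ i), B j := (iSup₂_mono fun j _ => hAB j) hz
  have hzB : z ∈ B i := by simpa using (B i).sub_mem hx (hAB i hy)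
  have : z = 0 := Submodule.disjoint_def.1 (iSupIndep_def.1 hB i) z hzB hz'
  simpa [this] using hy

theorem span_range_eq_of_card {K V ι : Type*} [Field K] [AddCommGroup V] [Module K V]
    [FiniteDimensional K V] [Fintype ι] {v : ι → V} (hv : LinearIndependent K v)
    {S : Submodule K V} (hS : ∀ i, v i ∈ S) (hc : Module.finrank K S ≤ Fintype.card ι) :
    Submodule.span K (Set.range v) = S := by
  refine Submodule.eq_of_le_of_finrank_le (Submodule.span_le.2 ?_) ?_
  · rintro _ ⟨i, rfl⟩
    exact hS i
  · rwa [finrank_span_eq_card hv]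

theorem pow_skew {W : Type*} [AddCommGroup W] [Module ℂ W] {S : Submodule ℂ W}
    {Q : W →ₗ[ℂ] W →ₗ[ℂ] ℂ} {N : W →ₗ[ℂ] W} (hNS : ∀ v ∈ S, N v ∈ S)
    (hskew : ∀ u ∈ S, ∀ v ∈ S, Q (N u) v + Q u (N v) = 0) (a : ℕ) :
    ∀ u ∈ S, ∀ v ∈ S, Q ((N ^ a) u) v = (-1) ^ a * Q u ((N ^ a) v) := by
  induction a with
  | zero => simp
  | succ a ih =>
    intro u hu v hv
    rw [pow_succ, Module.End.mul_apply, ih _ (hNS u hu) v hv]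
    have hmem : (N ^ a) v ∈ S := by
      clear ih
      induction a with
      | zero => simpa
      | succ a ih => rw [pow_succ', Module.End.mul_apply]; exact hNS _ ih
    have h := hskew u hu _ hmem
    rw [← Module.End.mul_apply, ← pow_succ'] at h
    rw [eq_neg_of_add_eq_zero_left h, pow_succ, pow_succ (-1 : ℂ), Module.End.mul_apply]
    ring_nf

theorem pow_mem_of_stable {K V : Type*} [Field K] [AddCommGroup V] [Module K V]
    {S : Submodule K V} {N : V →ₗ[K] V} (hNS : ∀ v ∈ S, N v ∈ S) (a : ℕ) :
    ∀ v ∈ S, (N ^ a) v ∈ S := by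
  induction a with
  | zero => simp
  | succ a ih =>
    intro v hv
    rw [pow_succ', Module.End.mul_apply]
    exact hNS _ (ih v hv)

theorem pow_apply_eq_zero_of_le {K V : Type*} [Field K] [AddCommGroup V] [Module K V]
    {N : V →ₗ[K] V} {v : V} {a b : ℕ} (h : (N ^ a) v = 0) (hab : a ≤ b) : (N ^ b) v = 0 := by
  obtain ⟨c, rfl⟩ := Nat.exists_eq_add_of_le hab
  rw [add_comm, pow_add, Module.End.mul_apply, h, map_zero]

theorem pow_comm_conj {W : Type*} [AddCommGroup W] [Module ℂ W] {S : Submodule ℂ W}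
    {σ : W →ₛₗ[starRingEnd ℂ] W} {N : W →ₗ[ℂ] W} (hNS : ∀ v ∈ S, N v ∈ S)
    (hNσ : ∀ v ∈ S, N (σ v) = σ (N v)) (a : ℕ) :
    ∀ v ∈ S, (N ^ a) (σ v) = σ ((N ^ a) v) := by
  induction a with
  | zero => simp
  | succ a ih =>
    intro v hv
    rw [pow_succ, Module.End.mul_apply, Module.End.mul_apply, hNσ v hv, ih _ (hNS v hv)]

/-- A family of strings `e t, N (e t), …, N ^ ℓ t (e t)` spanning `S`, compatible with conjugation
and with the bigrading `I`, in which distinct strings pair to zero unless they are conjugate. -/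
structure IsStringFamily {W : Type*} [AddCommGroup W] [Module ℂ W]
    (n : ℤ) (S : Submodule ℂ W) (σ : W →ₛₗ[starRingEnd ℂ] W) (Q : W →ₗ[ℂ] W →ₗ[ℂ] ℂ)
    (I : ℤ → ℤ → Submodule ℂ W) (N : W →ₗ[ℂ] W) {T : Type*} [Fintype T]
    (ℓ : T → ℕ) (P R : T → ℤ) (bar : T → T) (e : T → W) : Prop where
  weight : ∀ t, P t + R t = n + ℓ t
  bar_bar : ∀ t, bar (bar t) = t
  P_bar : ∀ t, P (bar t) = R t
  pow_eq_zero : ∀ t, (N ^ (ℓ t + 1)) (e t) = 0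
  mem : ∀ t, e t ∈ S
  stable : ∀ v ∈ S, N v ∈ S
  conj_mem : ∀ v ∈ S, σ v ∈ S
  skew : ∀ u ∈ S, ∀ v ∈ S, Q (N u) v + Q u (N v) = 0
  comm_conj : ∀ v ∈ S, N (σ v) = σ (N v)
  conj_e : ∀ t, σ (e t) = e (bar t)
  indep : iSupIndep (fun pq : ℤ × ℤ => I pq.1 pq.2)
  le : ∀ p q : ℤ, I p q ≤ S
  mem_I : ∀ t a, a ≤ ℓ t → (N ^ a) (e t) ∈ I (P t - a) (R t - a)
  orth : ∀ t t' a, ¬ (t' = bar t ∧ a = ℓ t) → Q (e t) ((N ^ a) (e t')) = 0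
  pos : ∀ t, ∃ r : ℝ, 0 < r ∧
    Complex.I ^ (P t - R t) * Q (e t) ((N ^ ℓ t) (e (bar t))) = (r : ℂ)
  card : Module.finrank ℂ S ≤ ∑ t, (ℓ t + 1)

namespace IsStringFamily

variable {W : Type*} [AddCommGroup W] [Module ℂ W] {n : ℤ} {S : Submodule ℂ W}
  {σ : W →ₛₗ[starRingEnd ℂ] W} {Q : W →ₗ[ℂ] W →ₗ[ℂ] ℂ} {I : ℤ → ℤ → Submodule ℂ W}
  {N : W →ₗ[ℂ] W} {T : Type*} [Fintype T] {ℓ : T → ℕ} {P R : T → ℤ} {bar : T → T} {e : T → W}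

theorem R_bar (h : IsStringFamily n S σ Q I N ℓ P R bar e) (t : T) : R (bar t) = P t := by
  rw [← h.P_bar (bar t), h.bar_bar]

theorem len_bar (h : IsStringFamily n S σ Q I N ℓ P R bar e) (t : T) : ℓ (bar t) = ℓ t := by
  have h1 := h.weight t
  have h2 := h.weight (bar t)
  rw [h.P_bar, h.R_bar] at h2
  omega

theorem pow_mem (h : IsStringFamily n S σ Q I N ℓ P R bar e) (t : T) (a : ℕ) :
    (N ^ a) (e t) ∈ S := pow_mem_of_stable h.stable a _ (h.mem t)

theorem gram (h : IsStringFamily n S σ Q I N ℓ P R bar e) (t t' : T) (a b : ℕ) :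
    Q ((N ^ a) (e t)) ((N ^ b) (e t')) = (-1) ^ a * Q (e t) ((N ^ (a + b)) (e t')) := by
  rw [pow_skew h.stable h.skew a _ (h.mem t) _ (h.pow_mem t' b), pow_add, Module.End.mul_apply]

theorem pairing_ne_zero (h : IsStringFamily n S σ Q I N ℓ P R bar e) (t : T) :
    Q (e t) ((N ^ ℓ t) (e (bar t))) ≠ 0 := by
  obtain ⟨r, hr, hr'⟩ := h.pos t
  intro h0
  rw [h0, mul_zero] at hr'
  exact hr.ne (by exact_mod_cast hr')

theorem linearIndependent (h : IsStringFamily n S σ Q I N ℓ P R bar e) :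
    LinearIndependent ℂ (fun x : (t : T) × Fin (ℓ t + 1) => (N ^ (x.2 : ℕ)) (e x.1)) := by
  refine linearIndependent_of_biorthogonal _
    (fun x => Q.flip ((N ^ (ℓ x.1 - x.2)) (e (bar x.1)))) ?_ ?_
  · rintro ⟨t, a⟩ ⟨t', a'⟩ hne
    rw [LinearMap.flip_apply, h.gram, h.orth, mul_zero]
    rintro ⟨h1, h2⟩
    obtain rfl : t = t' := by rw [← h.bar_bar t, h1, h.bar_bar]
    refine hne ?_
    have : (a' : ℕ) = a := by have := a.2; simp only at h2; omega
    exact congrArg (Sigma.mk t) (Fin.ext this)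
  · rintro ⟨t, a⟩
    rw [LinearMap.flip_apply, h.gram]
    have ha : (a : ℕ) + (ℓ t - a) = ℓ t := by have := a.2; omega
    simp only [ha]
    exact mul_ne_zero (pow_ne_zero _ (by norm_num)) (h.pairing_ne_zero t)

theorem span_eq [FiniteDimensional ℂ W] (h : IsStringFamily n S σ Q I N ℓ P R bar e) :
    Submodule.span ℂ (Set.range
      (fun x : (t : T) × Fin (ℓ t + 1) => (N ^ (x.2 : ℕ)) (e x.1))) = S := by
  refine span_range_eq_of_card h.linearIndependent (fun x => h.pow_mem _ _) ?_
  simpa using h.card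

/-- The strings meeting bidegree `(p, q)`. -/
def Meets (ℓ : T → ℕ) (P R : T → ℤ) (p q : ℤ) (t : T) : Prop :=
  P t - p = R t - q ∧ 0 ≤ P t - p ∧ P t - p ≤ ℓ t

theorem exists_sum_of_mem_span {p q : ℤ} {u : W}
    (hu : u ∈ Submodule.span ℂ ((fun x : (t : T) × Fin (ℓ t + 1) => (N ^ (x.2 : ℕ)) (e x.1)) ''
      {x | ((P x.1 - (x.2 : ℕ), R x.1 - (x.2 : ℕ)) : ℤ × ℤ) = (p, q)})) :
    ∃ α : T → ℂ, (∀ t, ¬ Meets ℓ P R p q t → α t = 0) ∧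
      u = ∑ t, α t • (N ^ (P t - p).toNat) (e t) := by
  classical
  induction hu using Submodule.span_induction with
  | mem x hx =>
    obtain ⟨⟨t, a⟩, hta, rfl⟩ := hx
    simp only [Set.mem_ofPred_eq, Prod.mk.injEq] at hta
    have ha := a.2
    refine ⟨Pi.single t 1, fun t' ht' => Pi.single_eq_of_ne ?_ _, ?_⟩
    · rintro rfl
      exact ht' ⟨by omega, by omega, by omega⟩
    · rw [Finset.sum_eq_single_of_mem t (Finset.mem_univ _)]
      · rw [Pi.single_eq_same, one_smul, show (P t - p).toNat = a by omega]
      · intro t' _ ht'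
        rw [Pi.single_eq_of_ne ht', zero_smul]
  | zero => exact ⟨0, by simp, by simp⟩
  | add x y _ _ hx hy =>
    obtain ⟨α, hα, rfl⟩ := hx
    obtain ⟨β, hβ, rfl⟩ := hy
    exact ⟨α + β, fun t ht => by simp [hα t ht, hβ t ht], by
      simp [add_smul, Finset.sum_add_distrib]⟩
  | smul c x _ hx =>
    obtain ⟨α, hα, rfl⟩ := hx
    exact ⟨c • α, fun t ht => by simp [hα t ht], by simp [Finset.smul_sum, mul_smul]⟩

theorem I_eq_span [FiniteDimensional ℂ W] (h : IsStringFamily n S σ Q I N ℓ P R bar e)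
    (p q : ℤ) : Submodule.span ℂ
      ((fun x : (t : T) × Fin (ℓ t + 1) => (N ^ (x.2 : ℕ)) (e x.1)) ''
      {x | ((P x.1 - (x.2 : ℕ), R x.1 - (x.2 : ℕ)) : ℤ × ℤ) = (p, q)}) = I p q := by
  refine iSupIndep.eq_of_le (A := fun pq : ℤ × ℤ => Submodule.span ℂ
      ((fun x : (t : T) × Fin (ℓ t + 1) => (N ^ (x.2 : ℕ)) (e x.1)) ''
      {x | ((P x.1 - (x.2 : ℕ), R x.1 - (x.2 : ℕ)) : ℤ × ℤ) = pq})) h.indep ?_ ?_ (p, q)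
  · rintro ⟨p, q⟩
    refine Submodule.span_le.2 ?_
    rintro _ ⟨⟨t, a⟩, hta, rfl⟩
    simp only [Set.mem_ofPred_eq, Prod.mk.injEq] at hta
    have := h.mem_I t a (by have := a.2; omega)
    rwa [hta.1, hta.2] at this
  · rintro ⟨p, q⟩
    refine (h.le p q).trans ?_
    rw [← h.span_eq]
    refine Submodule.span_le.2 ?_
    rintro _ ⟨x, rfl⟩
    exact Submodule.mem_iSup_of_mem (P x.1 - (x.2 : ℕ), R x.1 - (x.2 : ℕ))
      (Submodule.subset_span ⟨x, rfl, rfl⟩)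

theorem exists_sum [FiniteDimensional ℂ W] (h : IsStringFamily n S σ Q I N ℓ P R bar e)
    {p q : ℤ} {u : W} (hu : u ∈ I p q) :
    ∃ α : T → ℂ, (∀ t, ¬ Meets ℓ P R p q t → α t = 0) ∧
      u = ∑ t, α t • (N ^ (P t - p).toNat) (e t) := by
  rw [← h.I_eq_span] at hu
  exact exists_sum_of_mem_span hu

theorem iSup_eq [FiniteDimensional ℂ W] (h : IsStringFamily n S σ Q I N ℓ P R bar e) :
    (⨆ pq : ℤ × ℤ, I pq.1 pq.2) = S := by
  refine le_antisymm (iSup_le fun pq => h.le _ _) ?_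
  rw [← h.span_eq]
  refine Submodule.span_le.2 ?_
  rintro _ ⟨x, rfl⟩
  exact Submodule.mem_iSup_of_mem (P x.1 - (x.2 : ℕ), R x.1 - (x.2 : ℕ))
    (h.mem_I x.1 x.2 (by have := x.2.2; omega))

theorem mem_I_of_sum (h : IsStringFamily n S σ Q I N ℓ P R bar e)
    {p q : ℤ} {α : T → ℂ} (hα : ∀ t, ¬ Meets ℓ P R p q t → α t = 0) :
    ∑ t, α t • (N ^ (P t - p).toNat) (e t) ∈ I p q := by
  refine Submodule.sum_mem _ fun t _ => ?_
  by_cases ht : Meets ℓ P R p q t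
  · obtain ⟨h1, h2, h3⟩ := ht
    have := h.mem_I t (P t - p).toNat (by omega)
    rw [show P t - ((P t - p).toNat : ℕ) = p by omega,
      show R t - ((P t - p).toNat : ℕ) = q by omega] at this
    exact Submodule.smul_mem _ _ this
  · rw [hα t ht, zero_smul]
    exact zero_mem _

theorem conj_mem_I [FiniteDimensional ℂ W] (h : IsStringFamily n S σ Q I N ℓ P R bar e)
    {p q : ℤ} {u : W} (hu : u ∈ I p q) : σ u ∈ I q p := by
  obtain ⟨α, hα, rfl⟩ := h.exists_sum hu
  rw [map_sum]
  refine Submodule.sum_mem _ fun t _ => ?_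
  by_cases ht : Meets ℓ P R p q t
  · obtain ⟨h1, h2, h3⟩ := ht
    rw [map_smulₛₗ, ← pow_comm_conj h.stable h.comm_conj _ _ (h.mem t), h.conj_e]
    have := h.mem_I (bar t) (P t - p).toNat (by rw [h.len_bar]; omega)
    rw [h.P_bar, h.R_bar, show P t - ((P t - p).toNat : ℕ) = p by omega,
      show R t - ((P t - p).toNat : ℕ) = q by omega] at this
    exact Submodule.smul_mem _ _ this
  · rw [hα t ht, zero_smul, map_zero]
    exact zero_mem _

theorem map_mem_I [FiniteDimensional ℂ W] (h : IsStringFamily n S σ Q I N ℓ P R bar e)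
    {p q : ℤ} {u : W} (hu : u ∈ I p q) : N u ∈ I (p - 1) (q - 1) := by
  obtain ⟨α, hα, rfl⟩ := h.exists_sum hu
  rw [map_sum]
  refine Submodule.sum_mem _ fun t _ => ?_
  by_cases ht : Meets ℓ P R p q t
  · obtain ⟨h1, h2, h3⟩ := ht
    rw [map_smul, ← Module.End.mul_apply, ← pow_succ']
    by_cases hl : (P t - p).toNat + 1 ≤ ℓ t
    · have := h.mem_I t ((P t - p).toNat + 1) hl
      rw [show P t - ((P t - p).toNat + 1 : ℕ) = p - 1 by omega,
        show R t - ((P t - p).toNat + 1 : ℕ) = q - 1 by omega] at this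
      exact Submodule.smul_mem _ _ this
    · rw [pow_apply_eq_zero_of_le (h.pow_eq_zero t) (by omega), smul_zero]
      exact zero_mem _
  · rw [hα t ht, zero_smul, map_zero]
    exact zero_mem _

theorem orth_I [FiniteDimensional ℂ W] (h : IsStringFamily n S σ Q I N ℓ P R bar e)
    {p q r s : ℤ} (hne : p + r ≠ n ∨ q + s ≠ n) {u v : W} (hu : u ∈ I p q) (hv : v ∈ I r s) :
    Q u v = 0 := by
  obtain ⟨α, hα, rfl⟩ := h.exists_sum hu
  obtain ⟨β, hβ, rfl⟩ := h.exists_sum hv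
  simp only [map_sum, map_smul, LinearMap.sum_apply, LinearMap.smul_apply]
  refine Finset.sum_eq_zero fun t' _ => ?_
  by_cases ht' : Meets ℓ P R r s t'
  · rw [Finset.sum_eq_zero, smul_zero]
    intro t _
    by_cases ht : Meets ℓ P R p q t
    · rw [h.gram, h.orth, mul_zero, smul_zero]
      rintro ⟨rfl, h2⟩
      obtain ⟨h3, h4, h5⟩ := ht
      obtain ⟨h6, h7, h8⟩ := ht'
      rw [h.P_bar, h.R_bar] at *
      rw [h.len_bar] at h8
      have := h.weight t
      omega
    · rw [hα t ht, zero_smul]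
  · rw [hβ t' ht', zero_smul]

theorem eq_zero_of_pow [FiniteDimensional ℂ W] (h : IsStringFamily n S σ Q I N ℓ P R bar e)
    {p : ℤ} {k : ℕ} {α : T → ℂ} (h0 : ∑ t, α t • (N ^ (k + (P t - p).toNat)) (e t) = 0)
    {t : T} (ht : k + (P t - p).toNat ≤ ℓ t) : α t = 0 := by
  have h1 := congrArg (Q.flip ((N ^ (ℓ t - (k + (P t - p).toNat))) (e (bar t)))) h0
  rw [map_zero, map_sum, Finset.sum_eq_single_of_mem t (Finset.mem_univ _)] at h1
  · rw [map_smul, LinearMap.flip_apply, h.gram, Nat.add_sub_cancel' ht, smul_eq_mul] at h1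
    simpa [h.pairing_ne_zero t] using h1
  · intro t' _ hne
    rw [map_smul, LinearMap.flip_apply, h.gram, h.orth, mul_zero, smul_zero]
    rintro ⟨h2, -⟩
    exact hne (by rw [← h.bar_bar t', ← h2, h.bar_bar])

theorem isRSplitPMHSOn [FiniteDimensional ℂ W] (h : IsStringFamily n S σ Q I N ℓ P R bar e) :
    IsRSplitPMHSOn n S σ Q I N := by
  refine ⟨⟨∑ t, (ℓ t + 1), fun v hv => ?_⟩, h.skew, h.stable, h.conj_mem, h.comm_conj, h.le,
    h.indep, h.iSup_eq, fun p q u => h.conj_mem_I, fun p q u => h.map_mem_I,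
    fun p q r s hne u hu v hv => h.orth_I hne hu hv, fun k p q hpq => ⟨fun u hu h0 => ?_,
    fun v hv => ?_⟩, fun k p q hpq u hu h0 hne => ?_⟩
  · rw [← h.span_eq] at hv
    induction hv using Submodule.span_induction with
    | mem x hx =>
      obtain ⟨⟨t, a⟩, rfl⟩ := hx
      simp only
      rw [← Module.End.mul_apply, ← pow_add]
      refine pow_apply_eq_zero_of_le (h.pow_eq_zero t) ?_
      exact (Finset.single_le_sum (f := fun t => ℓ t + 1) (fun _ _ => Nat.zero_le _)
        (Finset.mem_univ t)).trans (Nat.le_add_right _ _)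
    | zero => simp
    | add x y _ _ hx hy => rw [map_add, hx, hy, add_zero]
    | smul c x _ hx => rw [map_smul, hx, smul_zero]
  · obtain ⟨α, hα, rfl⟩ := h.exists_sum hu
    simp only [map_sum, map_smul, ← Module.End.mul_apply, ← pow_add] at h0
    refine Finset.sum_eq_zero fun t _ => ?_
    by_cases ht : Meets ℓ P R p q t
    · obtain ⟨h1, h2, h3⟩ := ht
      have := h.weight t
      rw [h.eq_zero_of_pow h0 (t := t) (by omega), zero_smul]
    · rw [hα t ht, zero_smul]
  · obtain ⟨α, hα, rfl⟩ := h.exists_sum hv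
    have key : ∀ t, Meets ℓ P R (p - k) (q - k) t → Meets ℓ P R p q t := by
      rintro t ⟨h1, h2, h3⟩
      have := h.weight t
      exact ⟨by omega, by omega, by omega⟩
    refine ⟨_, h.mem_I_of_sum fun t ht => hα t fun ht' => ht (key t ht'), ?_⟩
    simp only [map_sum, map_smul, ← Module.End.mul_apply, ← pow_add]
    refine Finset.sum_congr rfl fun t _ => ?_
    by_cases ht : Meets ℓ P R (p - k) (q - k) t
    · obtain ⟨h1, h2, h3⟩ := key t ht
      rw [show k + (P t - p).toNat = (P t - (p - k)).toNat by omega]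
    · rw [hα t ht, zero_smul, zero_smul]
  · obtain ⟨α, hα, rfl⟩ := h.exists_sum hu
    have h0' := h0
    simp only [map_sum, map_smul, ← Module.End.mul_apply, ← pow_add] at h0'
    have hα' : ∀ t, ¬ (P t = p ∧ R t = q) → α t = 0 := by
      intro t ht
      by_cases ht' : Meets ℓ P R p q t
      · obtain ⟨h1, h2, h3⟩ := ht'
        have := h.weight t
        exact h.eq_zero_of_pow h0' (t := t) (by omega)
      · exact hα t ht'
    have hu' : ∑ t, α t • (N ^ (P t - p).toNat) (e t) = ∑ t, α t • e t := by
      refine Finset.sum_congr rfl fun t _ => ?_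
      by_cases ht : P t = p ∧ R t = q
      · simp [ht.1]
      · rw [hα' t ht, zero_smul, zero_smul]
    rw [hu'] at hne ⊢
    choose r hr hr' using h.pos
    have hsum : Complex.I ^ (p - q) * Q (∑ t, α t • e t) ((N ^ k) (σ (∑ t, α t • e t))) =
        ((∑ t, Complex.normSq (α t) * r t : ℝ) : ℂ) := by
      simp only [map_sum, map_smul, map_smulₛₗ, LinearMap.sum_apply, LinearMap.smul_apply,
        h.conj_e, smul_eq_mul, Finset.mul_sum]
      push_cast
      rw [Finset.sum_comm]
      refine Finset.sum_congr rfl fun t _ => ?_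
      by_cases ht : P t = p ∧ R t = q
      · have hk : k = ℓ t := by have := h.weight t; omega
        rw [Finset.sum_eq_single_of_mem t (Finset.mem_univ _)]
        · rw [← hr' t, ← ht.1, ← ht.2, hk, ← Complex.mul_conj]
          ring
        · intro t' _ hne'
          rw [h.orth, mul_zero, mul_zero, mul_zero]
          rintro ⟨h1, -⟩
          exact hne' (by rw [← h.bar_bar t', h1, h.bar_bar])
      · simp [hα' t ht]
    refine ⟨_, ?_, hsum⟩
    obtain ⟨t, ht⟩ : ∃ t, α t ≠ 0 := by
      by_contra! hall
      exact hne (by simp [hall])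
    exact Finset.sum_pos' (fun t _ => mul_nonneg (Complex.normSq_nonneg _) (hr t).le)
      ⟨t, Finset.mem_univ _, mul_pos (Complex.normSq_pos.2 ht) (hr t)⟩

end IsStringFamily

open Finset Nat in
theorem sum_alternating_choose_mul_descFactorial {k d r A B : ℕ} (hrk : r ≤ k)
    (hA : A ≤ k) (hB : B ≤ d) (hAB : A + B + r = k + d) :
    ∑ a ∈ range (r + 1), (-1 : ℂ) ^ a * r.choose a *
      (((k - a).descFactorial (k - A) : ℂ) * ((d - r + a).descFactorial (d - B) : ℂ)) =
      (-1) ^ (r + k + A) * r ! := by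
  set F : Polynomial ℂ :=
    (descPochhammer ℂ (k - A)).comp
        (Polynomial.C (-1) * Polynomial.X + Polynomial.C (k : ℂ)) *
      (descPochhammer ℂ (d - B)).comp
        (Polynomial.C 1 * Polynomial.X + Polynomial.C ((d - r : ℕ) : ℂ)) with hF
  have hdeg : F.natDegree = r := by
    rw [hF, Polynomial.natDegree_mul', Polynomial.natDegree_comp, Polynomial.natDegree_comp,
      Polynomial.natDegree_linear (by norm_num), Polynomial.natDegree_linear (by norm_num),
      descPochhammer_natDegree, descPochhammer_natDegree]
    · omega
    · rw [Polynomial.leadingCoeff_comp, Polynomial.leadingCoeff_comp,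
        Polynomial.leadingCoeff_linear (by norm_num), Polynomial.leadingCoeff_linear (by norm_num),
        (monic_descPochhammer ℂ _).leadingCoeff, (monic_descPochhammer ℂ _).leadingCoeff]
      · simp
      all_goals rw [Polynomial.natDegree_linear (by norm_num)]; norm_num
  have hlead : F.leadingCoeff = (-1) ^ (k - A) := by
    rw [hF, Polynomial.leadingCoeff_mul, Polynomial.leadingCoeff_comp,
      Polynomial.leadingCoeff_comp, Polynomial.leadingCoeff_linear (by norm_num),
      Polynomial.leadingCoeff_linear (by norm_num), descPochhammer_natDegree,
      descPochhammer_natDegree, (monic_descPochhammer ℂ _).leadingCoeff,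
      (monic_descPochhammer ℂ _).leadingCoeff]
    · simp
    all_goals rw [Polynomial.natDegree_linear (by norm_num)]; norm_num
  have h := congrFun (Polynomial.fwdDiff_iter_degree_eq_factorial F) 0
  rw [hdeg, fwdDiff_iter_eq_sum_shift, hlead] at h
  have heval : ∀ a ∈ range (r + 1), F.eval (a : ℂ) =
      ((k - a).descFactorial (k - A) : ℂ) * ((d - r + a).descFactorial (d - B) : ℂ) := by
    intro a ha
    have ha' : a ≤ k := by have := mem_range.1 ha; omega
    rw [hF, Polynomial.eval_mul, Polynomial.eval_comp, Polynomial.eval_comp,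
      ← descPochhammer_eval_eq_descFactorial, ← descPochhammer_eval_eq_descFactorial,
      Nat.cast_sub ha', Nat.cast_add]
    simp only [Polynomial.eval_add, Polynomial.eval_mul, Polynomial.eval_C, Polynomial.eval_X]
    ring_nf
  have h2 : ∑ a ∈ range (r + 1), (-1 : ℂ) ^ a * r.choose a *
      (((k - a).descFactorial (k - A) : ℂ) * ((d - r + a).descFactorial (d - B) : ℂ)) =
      (-1) ^ r * ((-1) ^ (k - A) * r !) := by
    have h3 : (-1 : ℂ) ^ (k - A) * r ! = ((-1 : ℂ) ^ (k - A) • ((r ! : ℕ) : ℂ → ℂ)) 0 := by simp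
    rw [h3, ← h, mul_sum]
    refine sum_congr rfl fun a ha => ?_
    have ha' : a ≤ r := by have := mem_range.1 ha; omega
    have hs : (-1 : ℂ) ^ r * (-1) ^ (r - a) = (-1) ^ a := by
      rw [← pow_add, neg_one_pow_eq_pow_mod_two, neg_one_pow_eq_pow_mod_two (n := a)]
      congr 1
      omega
    simp only [zero_add, nsmul_eq_mul, mul_one, zsmul_eq_mul, Int.cast_mul, Int.cast_pow,
      Int.cast_neg, Int.cast_one, Int.cast_natCast]
    rw [heval a ha, ← hs]
    ring
  rw [h2, ← mul_assoc, ← pow_add]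
  congr 1
  rw [neg_one_pow_eq_pow_mod_two, neg_one_pow_eq_pow_mod_two (n := r + k + A)]
  congr 1
  omega

/-- The absolute values of the coefficients of the primitive vector of degree `r` in the tensor
product of two strings of lengths `k` and `d`. -/
noncomputable def cgCoeff (k d r a : ℕ) : ℝ :=
  ((k - a).factorial * (d - r + a).factorial : ℝ) / (a.factorial * (r - a).factorial)

theorem cgCoeff_pos (k d r a : ℕ) : 0 < cgCoeff k d r a := by
  unfold cgCoeff
  positivity

open Finset Nat in
theorem sum_cgCoeff_mul_choose {k d r A B : ℕ} (hrk : r ≤ k) (hrd : r ≤ d)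
    (hA : A ≤ k) (hB : B ≤ d) (hAB : A + B + r = k + d) :
    ∑ a ∈ range (r + 1), (-1 : ℂ) ^ a * cgCoeff k d r a *
      (if a ≤ A then ((k + d - 2 * r).choose (A - a) : ℂ) else 0) =
      (-1) ^ (r + k + A) * (k + d - 2 * r)! := by
  have hr0 : (r ! : ℂ) ≠ 0 := by exact_mod_cast r.factorial_ne_zero
  have h := sum_alternating_choose_mul_descFactorial hrk hA hB hAB
  have h2 : ∑ a ∈ range (r + 1), (-1 : ℂ) ^ a * cgCoeff k d r a *
      (if a ≤ A then ((k + d - 2 * r).choose (A - a) : ℂ) else 0) =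
      ((k + d - 2 * r)! / r ! : ℂ) * ∑ a ∈ range (r + 1), (-1 : ℂ) ^ a * r.choose a *
      (((k - a).descFactorial (k - A) : ℂ) * ((d - r + a).descFactorial (d - B) : ℂ)) := by
    rw [mul_sum]
    refine sum_congr rfl fun a ha => ?_
    have ha' : a ≤ r := by have := mem_range.1 ha; omega
    split_ifs with haA
    · by_cases hl : A - a ≤ k + d - 2 * r
      · have e1 := Nat.factorial_mul_descFactorial (n := k - a) (k := k - A) (by omega)
        have e2 := Nat.factorial_mul_descFactorial (n := d - r + a) (k := d - B) (by omega)
        have e3 := Nat.choose_mul_factorial_mul_factorial hl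
        have e4 := Nat.choose_mul_factorial_mul_factorial ha'
        rw [show k - a - (k - A) = A - a by omega] at e1
        rw [show d - r + a - (d - B) = k + d - 2 * r - (A - a) by omega] at e2
        unfold cgCoeff
        push_cast
        rw [← e1, ← e2, ← e3, ← e4]
        have f1 : ((A - a)! : ℂ) ≠ 0 := by exact_mod_cast Nat.factorial_ne_zero _
        have f2 : ((k + d - 2 * r - (A - a))! : ℂ) ≠ 0 := by exact_mod_cast Nat.factorial_ne_zero _
        have f3 : (a ! : ℂ) ≠ 0 := by exact_mod_cast Nat.factorial_ne_zero _
        have f4 : ((r - a)! : ℂ) ≠ 0 := by exact_mod_cast Nat.factorial_ne_zero _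
        have f5 : (r.choose a : ℂ) ≠ 0 := by exact_mod_cast (Nat.choose_pos ha').ne'
        push_cast
        field_simp
      · rw [Nat.choose_eq_zero_of_lt (by omega),
          Nat.descFactorial_of_lt (n := d - r + a) (by omega)]
        simp
    · rw [Nat.descFactorial_of_lt (n := k - a) (by omega)]
      simp
  rw [h2, h]
  field_simp

theorem add_pow_apply_grid {K V : Type*} [Field K] [AddCommGroup V] [Module K V]
    {N₁ N' : V →ₗ[K] V} (hcomm : Commute N₁ N') {x : ℕ → ℕ → V}
    (h1 : ∀ c a, N₁ (x c a) = x c (a + 1)) (h2 : ∀ c a, N' (x c a) = x (c + 1) a) (j c a : ℕ) :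
    ((N₁ + N') ^ j) (x c a) =
      ∑ i ∈ Finset.range (j + 1), (j.choose i : K) • x (c + (j - i)) (a + i) := by
  have hp1 : ∀ i c a, (N₁ ^ i) (x c a) = x c (a + i) := by
    intro i
    induction i with
    | zero => simp
    | succ i ih => intro c a; rw [pow_succ', Module.End.mul_apply, ih, h1, add_assoc]
  have hp2 : ∀ i c a, (N' ^ i) (x c a) = x (c + i) a := by
    intro i
    induction i with
    | zero => simp
    | succ i ih => intro c a; rw [pow_succ', Module.End.mul_apply, ih, h2, add_assoc]
  rw [hcomm.add_pow, LinearMap.sum_apply]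
  refine Finset.sum_congr rfl fun i _ => ?_
  rw [← Nat.cast_comm, Module.End.mul_apply, Module.End.mul_apply, hp2, hp1,
    Module.End.natCast_apply, Nat.cast_smul_eq_nsmul]

/-- The primitive vector of degree `r` in the grid `x`. -/
noncomputable def cgVector {W : Type*} [AddCommGroup W] [Module ℂ W] (x : ℕ → ℕ → W)
    (k d r : ℕ) : W :=
  ∑ a ∈ Finset.range (r + 1), ((-1 : ℂ) ^ a * cgCoeff k d r a) • x (r - a) a

open Nat in
theorem pow_cgVector {W : Type*} [AddCommGroup W] [Module ℂ W]
    {N₁ N' : W →ₗ[ℂ] W} (hcomm : Commute N₁ N') {x : ℕ → ℕ → W}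
    (h1 : ∀ c a, N₁ (x c a) = x c (a + 1)) (h2 : ∀ c a, N' (x c a) = x (c + 1) a)
    {k d r : ℕ} (hk : ∀ c a, k < a → x c a = 0) (hd : ∀ c a, d < c → x c a = 0)
    (hrk : r ≤ k) (hrd : r ≤ d) :
    ((N₁ + N') ^ (k + d - 2 * r)) (cgVector x k d r) =
      ∑ A ∈ Finset.range (k + 1),
        ((-1 : ℂ) ^ (r + k + A) * (k + d - 2 * r)!) • x (k + d - r - A) A := by
  set l := k + d - 2 * r with hl
  have hshift : ∀ a ∈ Finset.range (r + 1), ((N₁ + N') ^ l) (x (r - a) a) =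
      ∑ A ∈ Finset.range (k + d + 1), (if a ≤ A then (l.choose (A - a) : ℂ) else 0) •
        x (k + d - r - A) A := by
    intro a ha
    have ha' : a ≤ r := by have := Finset.mem_range.1 ha; omega
    rw [add_pow_apply_grid hcomm h1 h2]
    refine Finset.sum_of_injOn (fun i => a + i) ?_ ?_ ?_ ?_
    · intro i _ j _ hij
      simpa using hij
    · intro i hi
      simp only [Finset.coe_range, Set.mem_Iio] at hi ⊢
      omega
    · intro A _ hA'
      split_ifs with haA
      · rw [Nat.choose_eq_zero_of_lt, Nat.cast_zero, zero_smul]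
        by_contra hcon
        exact hA' ⟨A - a, by simp; omega, by simp; omega⟩
      · rw [zero_smul]
    · intro i hi
      have hi' : i < l + 1 := Finset.mem_range.1 hi
      simp only [le_add_iff_nonneg_right, zero_le, if_true, add_tsub_cancel_left]
      rw [show r - a + (l - i) = k + d - r - (a + i) by omega]
  have hgrid : ∀ A, A ≤ k → d < k + d - r - A → x (k + d - r - A) A = 0 :=
    fun A _ h => hd _ _ h
  rw [cgVector, map_sum]
  simp only [map_smul]
  rw [Finset.sum_congr rfl fun a ha => by rw [hshift a ha, Finset.smul_sum], Finset.sum_comm]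
  rw [← Finset.sum_subset (Finset.range_mono (show k + 1 ≤ k + d + 1 by omega))]
  · refine Finset.sum_congr rfl fun A hA => ?_
    have hA' : A ≤ k := by have := Finset.mem_range.1 hA; omega
    by_cases hB : k + d - r - A ≤ d
    · simp only [smul_smul]
      rw [← Finset.sum_smul, sum_cgCoeff_mul_choose hrk hrd hA' hB (by omega)]
    · simp [hd _ A (not_le.1 hB)]
  · intro A _ hA
    have hA' : k < A := by simpa using hA
    simp [hk _ A hA']

theorem pow_succ_cgVector {W : Type*} [AddCommGroup W] [Module ℂ W]
    {N₁ N' : W →ₗ[ℂ] W} (hcomm : Commute N₁ N') {x : ℕ → ℕ → W}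
    (h1 : ∀ c a, N₁ (x c a) = x c (a + 1)) (h2 : ∀ c a, N' (x c a) = x (c + 1) a)
    {k d r : ℕ} (hk : ∀ c a, k < a → x c a = 0) (hd : ∀ c a, d < c → x c a = 0)
    (hrk : r ≤ k) (hrd : r ≤ d) :
    ((N₁ + N') ^ (k + d - 2 * r + 1)) (cgVector x k d r) = 0 := by
  rw [pow_succ', Module.End.mul_apply, pow_cgVector hcomm h1 h2 hk hd hrk hrd, map_sum]
  set z : ℕ → W := fun A => ((-1 : ℂ) ^ (r + k + A) * (k + d - 2 * r).factorial) •
    x (k + d - r + 1 - A) A with hz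
  have : ∀ A ∈ Finset.range (k + 1), (N₁ + N')
      (((-1 : ℂ) ^ (r + k + A) * (k + d - 2 * r).factorial) • x (k + d - r - A) A) =
      z A - z (A + 1) := by
    intro A hA
    have hA' : A ≤ k := by have := Finset.mem_range.1 hA; omega
    rw [map_smul, LinearMap.add_apply, h1, h2, hz]
    simp only
    rw [show k + d - r + 1 - (A + 1) = k + d - r - A by omega,
      show k + d - r + 1 - A = k + d - r - A + 1 by omega, ← add_assoc (r + k),
      pow_succ (-1 : ℂ) (r + k + A), smul_add]
    simp only [mul_neg, mul_one, neg_mul, neg_smul]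
    abel
  rw [Finset.sum_congr rfl this, Finset.sum_range_sub']
  simp [hz, hd (k + d - r + 1) 0 (by omega), hk _ (k + 1) (Nat.lt_succ_self k)]

theorem sigma_fin_ext {T : Type*} {f : T → ℕ} {x y : (t : T) × Fin (f t)} (h1 : x.1 = y.1)
    (h2 : (x.2 : ℕ) = y.2) : x = y := by
  obtain ⟨t, a⟩ := x
  obtain ⟨t', a'⟩ := y
  obtain rfl : t = t' := h1
  exact congrArg (Sigma.mk t) (Fin.ext h2)

theorem sum_range_min_string (k d : ℕ) :
    ∑ r ∈ Finset.range (min k d + 1), (k + d - 2 * r + 1) = (k + 1) * (d + 1) := by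
  have key : ∀ m, m ≤ min k d →
      ∑ r ∈ Finset.range (m + 1), (k + d - 2 * r + 1) = (m + 1) * (k + d + 1 - m) := by
    intro m
    induction m with
    | zero => simp
    | succ m ih =>
      intro hm
      rw [Finset.sum_range_succ, ih (by omega)]
      obtain ⟨s, hs⟩ : ∃ s, k + d = 2 * (m + 1) + s := ⟨k + d - 2 * (m + 1), by omega⟩
      rw [hs, show 2 * (m + 1) + s + 1 - m = m + 3 + s by omega,
        show 2 * (m + 1) + s + 1 - (m + 1) = m + 2 + s by omega, Nat.add_sub_cancel_left]
      ring
  rw [key _ le_rfl]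
  rcases le_total k d with h | h
  · rw [min_eq_left h, show k + d + 1 - k = d + 1 by omega]
  · rw [min_eq_right h, show k + d + 1 - d = k + 1 by omega, mul_comm]

/-- A family of grids `b t c a` (`c ≤ d t`, `a ≤ k t`) spanning `W`, on which the commuting
operators `N₁` and `N'` act by shifting `a` and `c`, and in which distinct grids pair to zero
unless they are conjugate. -/
structure IsGridFamily {W : Type*} [AddCommGroup W] [Module ℂ W]
    (n : ℤ) (σ : W →ₛₗ[starRingEnd ℂ] W) (Q : W →ₗ[ℂ] W →ₗ[ℂ] ℂ)
    (I : ℤ → ℤ → Submodule ℂ W) (N₁ N' : W →ₗ[ℂ] W) {T : Type*} [Fintype T]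
    (k d : T → ℕ) (P R : T → ℤ) (bar : T → T) (b : T → ℕ → ℕ → W) : Prop where
  weight : ∀ t, P t + R t = n + k t + d t
  bar_bar : ∀ t, bar (bar t) = t
  P_bar : ∀ t, P (bar t) = R t
  k_bar : ∀ t, k (bar t) = k t
  eq_zero_left : ∀ t c a, d t < c → b t c a = 0
  eq_zero_right : ∀ t c a, k t < a → b t c a = 0
  commute : Commute N₁ N'
  map_right : ∀ t c a, N₁ (b t c a) = b t c (a + 1)
  map_left : ∀ t c a, N' (b t c a) = b t (c + 1) a
  skew : ∀ u v, Q ((N₁ + N') u) v + Q u ((N₁ + N') v) = 0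
  comm_conj : ∀ v, (N₁ + N') (σ v) = σ ((N₁ + N') v)
  conj_b : ∀ t c a, σ (b t c a) = b (bar t) c a
  indep : iSupIndep (fun pq : ℤ × ℤ => I pq.1 pq.2)
  mem_I : ∀ t c a, c ≤ d t → a ≤ k t → b t c a ∈ I (P t - c - a) (R t - c - a)
  orth : ∀ t t' c c' a a', ¬ (t' = bar t ∧ c + c' = d t ∧ a + a' = k t) →
    Q (b t c a) (b t' c' a') = 0
  pairing : ∀ t c c' a a', c + c' = d t → a + a' = k t →
    Q (b t c a) (b (bar t) c' a') = (-1) ^ (a + c) * Complex.I ^ (R t - P t)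
  card : Module.finrank ℂ W ≤ ∑ t, (k t + 1) * (d t + 1)

namespace IsGridFamily

variable {W : Type*} [AddCommGroup W] [Module ℂ W] {n : ℤ}
  {σ : W →ₛₗ[starRingEnd ℂ] W} {Q : W →ₗ[ℂ] W →ₗ[ℂ] ℂ} {I : ℤ → ℤ → Submodule ℂ W}
  {N₁ N' : W →ₗ[ℂ] W} {T : Type*} [Fintype T] {k d : T → ℕ} {P R : T → ℤ} {bar : T → T}
  {b : T → ℕ → ℕ → W}

theorem R_bar (h : IsGridFamily n σ Q I N₁ N' k d P R bar b) (t : T) : R (bar t) = P t := by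
  rw [← h.P_bar (bar t), h.bar_bar]

theorem d_bar (h : IsGridFamily n σ Q I N₁ N' k d P R bar b) (t : T) : d (bar t) = d t := by
  have h1 := h.weight t
  have h2 := h.weight (bar t)
  rw [h.P_bar, h.R_bar, h.k_bar] at h2
  omega

theorem pow_cgVector_apply (h : IsGridFamily n σ Q I N₁ N' k d P R bar b) (t : T) (m r : ℕ) :
    ((N₁ + N') ^ m) (cgVector (b t) (k t) (d t) r) =
      ∑ a ∈ Finset.range (r + 1), ∑ i ∈ Finset.range (m + 1),
        ((-1 : ℂ) ^ a * cgCoeff (k t) (d t) r a * m.choose i) •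
          b t (r - a + (m - i)) (a + i) := by
  rw [cgVector, map_sum]
  refine Finset.sum_congr rfl fun a _ => ?_
  rw [map_smul, add_pow_apply_grid h.commute (h.map_right t) (h.map_left t), Finset.smul_sum]
  simp only [smul_smul]

theorem orth_pow_cgVector (h : IsGridFamily n σ Q I N₁ N' k d P R bar b) {t t' : T} {r r' m : ℕ}
    (hne : ¬ (t' = bar t ∧ r + r' + m = k t + d t)) :
    Q (cgVector (b t) (k t) (d t) r)
      (((N₁ + N') ^ m) (cgVector (b t') (k t') (d t') r')) = 0 := by
  rw [h.pow_cgVector_apply, cgVector]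
  simp only [map_sum, map_smul, LinearMap.sum_apply, LinearMap.smul_apply]
  refine Finset.sum_eq_zero fun a' ha' => Finset.sum_eq_zero fun i hi => ?_
  rw [Finset.sum_eq_zero, smul_zero]
  intro a ha
  have h1 := Finset.mem_range.1 ha
  have h2 := Finset.mem_range.1 ha'
  have h3 := Finset.mem_range.1 hi
  rw [h.orth, smul_zero]
  rintro ⟨h4, h5, h6⟩
  exact hne ⟨h4, by omega⟩

theorem pairing_cgVector (h : IsGridFamily n σ Q I N₁ N' k d P R bar b) {t : T} {r : ℕ}
    (hrk : r ≤ k t) (hrd : r ≤ d t) :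
    Q (cgVector (b t) (k t) (d t) r) (((N₁ + N') ^ (k t + d t - 2 * r))
      (cgVector (b (bar t)) (k (bar t)) (d (bar t)) r)) =
    Complex.I ^ (R t - P t) * (((k t + d t - 2 * r).factorial *
      ∑ a ∈ Finset.range (r + 1), cgCoeff (k t) (d t) r a : ℝ) : ℂ) := by
  have h1 := pow_cgVector h.commute (h.map_right (bar t)) (h.map_left (bar t))
    (h.eq_zero_right (bar t)) (h.eq_zero_left (bar t)) (r := r)
    (by rwa [h.k_bar]) (by rwa [h.d_bar])
  rw [h.k_bar, h.d_bar] at h1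
  rw [h.k_bar, h.d_bar, h1, cgVector]
  simp only [map_sum, map_smul, LinearMap.sum_apply, LinearMap.smul_apply, smul_eq_mul]
  push_cast
  rw [Finset.mul_sum, Finset.mul_sum]
  simp only [Finset.mul_sum]
  rw [Finset.sum_comm]
  refine Finset.sum_congr rfl fun a ha => ?_
  have ha' : a ≤ r := by have := Finset.mem_range.1 ha; omega
  rw [Finset.sum_eq_single_of_mem (k t - a) (Finset.mem_range.2 (by omega)),
    h.pairing t _ _ _ _ (by omega) (by omega)]
  · have hs : (-1 : ℂ) ^ (r + k t + (k t - a)) * (-1) ^ a * (-1) ^ (a + (r - a)) = 1 := by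
      rw [← pow_add, ← pow_add]
      exact Even.neg_one_pow ⟨r + k t, by omega⟩
    linear_combination (Complex.I ^ (R t - P t) * (k t + d t - 2 * r).factorial *
      cgCoeff (k t) (d t) r a) * hs
  · intro A _ hA
    rw [h.orth, mul_zero, mul_zero]
    rintro ⟨-, h2, h3⟩
    omega

theorem isStringFamily (h : IsGridFamily n σ Q I N₁ N' k d P R bar b) :
    IsStringFamily n ⊤ σ Q I (N₁ + N')
      (fun x : (t : T) × Fin (min (k t) (d t) + 1) => k x.1 + d x.1 - 2 * x.2)
      (fun x => P x.1 - (x.2 : ℕ)) (fun x => R x.1 - (x.2 : ℕ))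
      (fun x => ⟨bar x.1, Fin.cast (by rw [h.k_bar, h.d_bar]) x.2⟩)
      (fun x => cgVector (b x.1) (k x.1) (d x.1) x.2) where
  weight := by
    rintro ⟨t, r⟩
    have := h.weight t
    have := r.2
    simp only
    omega
  bar_bar x := sigma_fin_ext (h.bar_bar _) rfl
  P_bar x := by simp [h.P_bar]
  pow_eq_zero := by
    rintro ⟨t, r⟩
    have := r.2
    exact pow_succ_cgVector h.commute (h.map_right t) (h.map_left t) (h.eq_zero_right t)
      (h.eq_zero_left t) (by omega) (by omega)
  mem _ := Submodule.mem_top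
  stable _ _ := Submodule.mem_top
  conj_mem _ _ := Submodule.mem_top
  skew u _ v _ := h.skew u v
  comm_conj v _ := h.comm_conj v
  conj_e := by
    rintro ⟨t, r⟩
    simp only [cgVector, map_sum, map_smulₛₗ, h.conj_b, h.k_bar, h.d_bar, Fin.val_cast]
    simp
  indep := h.indep
  le _ _ := le_top
  mem_I := by
    rintro ⟨t, r⟩ j hj
    simp only at hj ⊢
    rw [h.pow_cgVector_apply]
    refine Submodule.sum_mem _ fun a ha => Submodule.sum_mem _ fun i hi => ?_
    have h1 := Finset.mem_range.1 ha
    have h2 := Finset.mem_range.1 hi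
    refine Submodule.smul_mem _ _ ?_
    by_cases hc : (r : ℕ) - a + (j - i) ≤ d t
    · by_cases hi' : a + i ≤ k t
      · have := h.mem_I t _ _ hc hi'
        convert this using 2 <;> omega
      · rw [h.eq_zero_right _ _ _ (not_le.1 hi')]
        exact zero_mem _
    · rw [h.eq_zero_left _ _ _ (not_le.1 hc)]
      exact zero_mem _
  orth := by
    rintro ⟨t, r⟩ ⟨t', r'⟩ m hne
    simp only at hne ⊢
    by_cases hdeg : t' = bar t ∧ (r : ℕ) + r' + m = k t + d t
    · obtain ⟨rfl, hdeg⟩ := hdeg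
      have hr := r.2
      have hr' := r'.2
      have hkb := h.k_bar t
      have hdb := h.d_bar t
      rcases lt_trichotomy (r : ℕ) r' with hlt | heq | hgt
      · have h1 := pow_succ_cgVector h.commute (h.map_right (bar t)) (h.map_left (bar t))
          (h.eq_zero_right (bar t)) (h.eq_zero_left (bar t)) (r := r')
          (by omega) (by omega)
        rw [pow_apply_eq_zero_of_le h1 (by omega), map_zero]
      · exact absurd ⟨sigma_fin_ext rfl heq.symm, by omega⟩ hne
      · have h1 := pow_succ_cgVector h.commute (h.map_right t) (h.map_left t)
          (h.eq_zero_right t) (h.eq_zero_left t) (r := r) (by omega) (by omega)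
        have h2 := pow_skew (S := ⊤) (fun _ _ => Submodule.mem_top)
          (fun u _ v _ => h.skew u v) m (cgVector (b t) (k t) (d t) r) Submodule.mem_top
          (cgVector (b (bar t)) (k (bar t)) (d (bar t)) r') Submodule.mem_top
        rw [pow_apply_eq_zero_of_le h1 (by omega), map_zero, LinearMap.zero_apply] at h2
        exact (mul_eq_zero.1 h2.symm).resolve_left (pow_ne_zero _ (by norm_num))
    · exact h.orth_pow_cgVector hdeg
  pos := by
    rintro ⟨t, r⟩
    have := r.2
    refine ⟨_, ?_, (?_ : _ = (((k t + d t - 2 * r).factorial *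
      ∑ a ∈ Finset.range (r + 1), cgCoeff (k t) (d t) r a : ℝ) : ℂ))⟩
    · refine mul_pos (by positivity) (Finset.sum_pos (fun a _ => cgCoeff_pos _ _ _ _) ?_)
      exact ⟨0, by simp⟩
    · simp only [Fin.val_cast]
      rw [h.pairing_cgVector (by omega) (by omega), ← mul_assoc,
        ← zpow_add₀ Complex.I_ne_zero]
      simp
  card := by
    rw [finrank_top, Fintype.sum_sigma]
    refine h.card.trans (Finset.sum_le_sum fun t _ => ?_)
    rw [← sum_range_min_string, Finset.sum_range]

end IsGridFamily

namespace IsRSplitPMHSOn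

variable {W : Type*} [AddCommGroup W] [Module ℂ W] {n : ℤ} {S : Submodule ℂ W}
  {σ : W →ₛₗ[starRingEnd ℂ] W} {Q : W →ₗ[ℂ] W →ₗ[ℂ] ℂ} {I : ℤ → ℤ → Submodule ℂ W}
  {N : W →ₗ[ℂ] W}

theorem stable (h : IsRSplitPMHSOn n S σ Q I N) : ∀ v ∈ S, N v ∈ S := h.2.2.1

theorem skew (h : IsRSplitPMHSOn n S σ Q I N) : ∀ u ∈ S, ∀ v ∈ S, Q (N u) v + Q u (N v) = 0 :=
  h.2.1

theorem comm_conj (h : IsRSplitPMHSOn n S σ Q I N) : ∀ v ∈ S, N (σ v) = σ (N v) :=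
  h.2.2.2.2.1

theorem le (h : IsRSplitPMHSOn n S σ Q I N) : ∀ p q, I p q ≤ S := h.2.2.2.2.2.1

theorem indep (h : IsRSplitPMHSOn n S σ Q I N) :
    iSupIndep (fun pq : ℤ × ℤ => I pq.1 pq.2) := h.2.2.2.2.2.2.1

theorem iSup_eq (h : IsRSplitPMHSOn n S σ Q I N) : (⨆ pq : ℤ × ℤ, I pq.1 pq.2) = S :=
  h.2.2.2.2.2.2.2.1

theorem conj_mem_I (h : IsRSplitPMHSOn n S σ Q I N) : ∀ p q, ∀ u ∈ I p q, σ u ∈ I q p :=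
  h.2.2.2.2.2.2.2.2.1

theorem map_mem_I (h : IsRSplitPMHSOn n S σ Q I N) :
    ∀ p q, ∀ u ∈ I p q, N u ∈ I (p - 1) (q - 1) :=
  h.2.2.2.2.2.2.2.2.2.1

theorem orth (h : IsRSplitPMHSOn n S σ Q I N) :
    ∀ p q r s, p + r ≠ n ∨ q + s ≠ n → ∀ u ∈ I p q, ∀ v ∈ I r s, Q u v = 0 :=
  h.2.2.2.2.2.2.2.2.2.2.1

theorem pow_bijective (h : IsRSplitPMHSOn n S σ Q I N) :
    ∀ k : ℕ, ∀ p q : ℤ, p + q = n + k → (∀ u ∈ I p q, (N ^ k) u = 0 → u = 0) ∧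
      (∀ v ∈ I (p - k) (q - k), ∃ u ∈ I p q, (N ^ k) u = v) :=
  h.2.2.2.2.2.2.2.2.2.2.2.1

theorem pos (h : IsRSplitPMHSOn n S σ Q I N) :
    ∀ k : ℕ, ∀ p q : ℤ, p + q = n + k → ∀ u ∈ I p q, (N ^ (k + 1)) u = 0 → u ≠ 0 →
      ∃ r : ℝ, 0 < r ∧ Complex.I ^ (p - q) * Q u ((N ^ k) (σ u)) = (r : ℂ) :=
  h.2.2.2.2.2.2.2.2.2.2.2.2

theorem pow_mem_I (h : IsRSplitPMHSOn n S σ Q I N) (a : ℕ) {p q : ℤ} {u : W} (hu : u ∈ I p q) :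
    (N ^ a) u ∈ I (p - a) (q - a) := by
  induction a with
  | zero => simpa
  | succ a ih =>
    rw [pow_succ', Module.End.mul_apply]
    convert h.map_mem_I _ _ _ ih using 2 <;> push_cast <;> ring

@[elab_as_elim]
theorem primC_induction {k : ℕ} {C : W → Prop} {u : W}
    (hu : u ∈ primC n I N k) (zero : C 0) (add : ∀ x y, C x → C y → C (x + y))
    (mem : ∀ p, ∀ x ∈ I p (n + k - p), (N ^ (k + 1)) x = 0 → C x) : C u :=
  Submodule.iSup_induction (motive := C) _ hu (fun p x hx => mem p x hx.2 hx.1) zero add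

theorem pow_eq_zero_of_mem_primC {k : ℕ} {u : W} (hu : u ∈ primC n I N k) :
    (N ^ (k + 1)) u = 0 := by
  refine primC_induction hu ?_ (fun x y hx hy => ?_) fun p x hx hx' => ?_
  · simp
  · rw [map_add, hx, hy, add_zero]
  · exact hx'

theorem conj_mem_primC (h : IsRSplitPMHSOn n S σ Q I N) {k : ℕ} {u : W}
    (hu : u ∈ primC n I N k) : σ u ∈ primC n I N k := by
  refine primC_induction hu ?_ (fun x y hx hy => ?_) fun p x hx hx' => ?_
  · simp
  · rw [map_add]; exact add_mem hx hy
  · refine Submodule.mem_iSup_of_mem (n + k - p) ⟨?_, ?_⟩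
    · rw [SetLike.mem_coe, LinearMap.mem_ker, pow_comm_conj h.stable h.comm_conj _ _ (h.le _ _ hx),
        hx', map_zero]
    · simpa using h.conj_mem_I _ _ _ hx

theorem eq_zero_of_le (h : IsRSplitPMHSOn n S σ Q I N) {m : ℕ} (hm : ∀ v ∈ S, (N ^ m) v = 0)
    {p q : ℤ} (hpq : n + m ≤ p + q) {u : W} (hu : u ∈ I p q) : u = 0 :=
  (h.pow_bijective (p + q - n).toNat p q (by omega)).1 u hu
    (pow_apply_eq_zero_of_le (hm u (h.le _ _ hu)) (by omega))

theorem primC_eq_bot (h : IsRSplitPMHSOn n S σ Q I N) {m k : ℕ}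
    (hm : ∀ v ∈ S, (N ^ m) v = 0) (hk : m ≤ k) : primC n I N k = ⊥ := by
  refine (Submodule.eq_bot_iff _).2 fun u hu => ?_
  refine primC_induction hu ?_ (fun x y hx hy => ?_) fun p x hx hx' => ?_
  · rfl
  · rw [hx, hy, add_zero]
  · exact h.eq_zero_of_le hm (by omega) hx

/-- Lefschetz decomposition: the primitive subspaces generate under `N`. -/
theorem le_of_primC_le (h : IsRSplitPMHSOn n S σ Q I N) {U : Submodule ℂ W}
    (hN : ∀ v ∈ U, N v ∈ U) (hU : ∀ k, primC n I N k ≤ U) : S ≤ U := by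
  obtain ⟨m, hm⟩ := h.1
  have key : ∀ d : ℕ, ∀ (j : ℕ) (p q : ℤ), m ≤ j + d → p + q = n + j → I p q ≤ U := by
    intro d
    induction d with
    | zero =>
      intro j p q hj hpq u hu
      rw [h.eq_zero_of_le hm (by omega) hu]
      exact zero_mem _
    | succ d ih =>
      intro j p q hj hpq u hu
      obtain ⟨w, hw, hwu⟩ := (h.pow_bijective (j + 2) (p + 1) (q + 1)
        (by push_cast; omega)).2 ((N ^ (j + 1)) u) (by
          convert h.pow_mem_I (j + 1) hu using 2 <;> push_cast <;> ring)
      have hw' : w ∈ U := ih (j + 2) (p + 1) (q + 1) (by omega) (by push_cast; omega) hw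
      have hdiff : u - N w ∈ primC n I N j := by
        refine Submodule.mem_iSup_of_mem p ⟨?_, ?_⟩
        · rw [SetLike.mem_coe, LinearMap.mem_ker, map_sub, ← Module.End.mul_apply, ← pow_succ, hwu,
            sub_self]
        · rw [show n + j - p = q by omega]
          exact sub_mem hu (by simpa using h.map_mem_I _ _ _ hw)
      simpa using add_mem (hU j hdiff) (hN w hw')
  rw [← h.iSup_eq]
  refine iSup_le fun pq => ?_
  rcases le_total n (pq.1 + pq.2) with hle | hle
  · exact key m (pq.1 + pq.2 - n).toNat _ _ (by omega) (by omega)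
  · intro v hv
    obtain ⟨j, hj⟩ : ∃ j : ℕ, (j : ℤ) = n - (pq.1 + pq.2) := ⟨_, Int.toNat_of_nonneg (by omega)⟩
    obtain ⟨u, hu, rfl⟩ := (h.pow_bijective j (pq.1 + j) (pq.2 + j) (by omega)).2 v (by simpa)
    exact pow_mem_of_stable hN j u (key m j _ _ (by omega) (by omega) hu)

theorem orth_primC (h : IsRSplitPMHSOn n S σ Q I N) {k k' a a' : ℕ}
    (hne : ¬ (k = k' ∧ a + a' = k)) {u v : W} (hu : u ∈ primC n I N k)
    (hv : v ∈ primC n I N k') : Q ((N ^ a) u) ((N ^ a') v) = 0 := by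
  refine primC_induction hu ?_ (fun x y hx hy => ?_) fun p x hx hx' => ?_
  · simp
  · rw [map_add, map_add, LinearMap.add_apply, hx, hy, add_zero]
  · refine primC_induction hv ?_ (fun x y hx hy => ?_) fun r y hy hy' => ?_
    · simp
    · rw [map_add, map_add, hx, hy, add_zero]
    · by_cases hdeg : k + k' = 2 * (a + a')
      · have hxS := h.le _ _ hx
        have hyS := h.le _ _ hy
        rcases lt_or_gt_of_ne (show k ≠ k' by omega) with hlt | hlt
        · have h1 := pow_skew h.stable h.skew a' _ (pow_mem_of_stable h.stable a _ hxS) _ hyS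
          rw [← Module.End.mul_apply, ← pow_add, pow_apply_eq_zero_of_le hx' (by omega), map_zero,
            LinearMap.zero_apply] at h1
          exact (mul_eq_zero.1 h1.symm).resolve_left (pow_ne_zero _ (by norm_num))
        · rw [pow_skew h.stable h.skew a _ hxS _ (pow_mem_of_stable h.stable a' _ hyS),
            ← Module.End.mul_apply, ← pow_add, pow_apply_eq_zero_of_le hy' (by omega), map_zero,
            mul_zero]
      · exact h.orth _ _ _ _ (by omega) _ (h.pow_mem_I a hx) _ (h.pow_mem_I a' hy)

end IsRSplitPMHSOn

theorem finrank_inf_ker_add_one {K V : Type*} [Field K] [AddCommGroup V] [Module K V]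
    [FiniteDimensional K V] {S : Submodule K V} {φ : V →ₗ[K] K} {w : V} (hw : w ∈ S)
    (hφ : φ w ≠ 0) : Module.finrank K ↥(S ⊓ LinearMap.ker φ) + 1 = Module.finrank K S := by
  rw [← Submodule.map_comap_subtype, Submodule.finrank_map_subtype_eq, ← LinearMap.ker_comp]
  refine Module.Dual.finrank_ker_add_one_of_ne_zero (f := φ ∘ₗ S.subtype) fun h => hφ ?_
  exact congrArg (fun f : S →ₗ[K] K => f ⟨w, hw⟩) h

/-- Abstract Gram–Schmidt: `h w` is the functional of pairing with `w`, and orthonormal vectors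
are chosen from `X` inside a class `G` of subspaces stable under orthogonal complements. -/
theorem exists_orthonormal_family {K V : Type*} [Field K] [AddCommGroup V] [Module K V]
    [FiniteDimensional K V] {h : V → V →ₗ[K] K} {X : Set V} {G : Submodule K V → Prop}
    (hG : ∀ S, G S → S ≠ ⊥ → ∃ w ∈ S, w ∈ X ∧ h w w = 1 ∧ G (S ⊓ LinearMap.ker (h w)))
    (hsymm : ∀ v w, h v w = 0 → h w v = 0) {S : Submodule K V} (hS : G S) :
    ∃ v : Fin (Module.finrank K S) → V, (∀ i, v i ∈ X) ∧
      Submodule.span K (Set.range v) = S ∧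
      ∀ i j, h (v j) (v i) = if i = j then 1 else 0 := by
  obtain ⟨v, hv⟩ : ∃ v : Fin (Module.finrank K S) → V, (∀ i, v i ∈ S ∧ v i ∈ X) ∧
      ∀ i j, h (v j) (v i) = if i = j then 1 else 0 := by
    generalize hd : Module.finrank K S = d
    induction d generalizing S with
    | zero => exact ⟨Fin.elim0, fun i => i.elim0, fun i => i.elim0⟩
    | succ d ih =>
      obtain ⟨w, hwS, hwX, hw1, hwG⟩ := hG S hS (by rintro rfl; simp at hd)
      have hfr := finrank_inf_ker_add_one hwS (show h w w ≠ 0 by simp [hw1])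
      obtain ⟨v, hv1, hv2⟩ := ih hwG (by omega)
      refine ⟨Fin.cons w v, Fin.cases ⟨hwS, hwX⟩ fun i => ⟨(hv1 i).1.1, (hv1 i).2⟩, ?_⟩
      have h0 : ∀ i, h w (v i) = 0 := fun i => (hv1 i).1.2
      refine Fin.cases (Fin.cases ?_ fun j => ?_) fun i => Fin.cases ?_ fun j => ?_
      · simpa using hw1
      · simpa [(Fin.succ_ne_zero j).symm] using hsymm _ _ (h0 j)
      · simpa using h0 i
      · simpa using hv2 i j
  refine ⟨v, fun i => (hv.1 i).2, ?_, hv.2⟩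
  refine span_range_eq_of_card (linearIndependent_of_biorthogonal v (fun i => h (v i)) ?_ ?_)
    (fun i => (hv.1 i).1) (by simp)
  · intro i j hij
    rw [hv.2, if_neg hij]
  · intro i
    simp [hv.2]

section

variable {W : Type*} [AddCommGroup W] [Module ℂ W] {σ : W →ₛₗ[starRingEnd ℂ] W}
  {B : W →ₗ[ℂ] W →ₗ[ℂ] ℂ} {c : ℂ} {A : Submodule ℂ W}

/-- The Hermitian form `c * B u (σ u)` is positive definite on `A`. -/
def IsPosDefOn (c : ℂ) (σ : W →ₛₗ[starRingEnd ℂ] W) (B : W →ₗ[ℂ] W →ₗ[ℂ] ℂ)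
    (A : Submodule ℂ W) : Prop :=
  ∀ u ∈ A, u ≠ 0 → ∃ r : ℝ, 0 < r ∧ c * B u (σ u) = r

theorem IsPosDefOn.exists_smul_eq_one (h : IsPosDefOn c σ B A) {u : W} (hu : u ∈ A)
    (hu0 : u ≠ 0) : ∃ t : ℝ, c * B ((t : ℂ) • u) (σ ((t : ℂ) • u)) = 1 := by
  obtain ⟨r, hr, hr'⟩ := h u hu hu0
  refine ⟨(√r)⁻¹, ?_⟩
  have : ((√r : ℝ) : ℂ) ^ 2 = r := by rw [← Complex.ofReal_pow, Real.sq_sqrt hr.le]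
  have h0 : ((√r : ℝ) : ℂ) ≠ 0 := by exact_mod_cast (Real.sqrt_pos.2 hr).ne'
  simp only [map_smulₛₗ, LinearMap.smul_apply, smul_eq_mul, Complex.conj_ofReal, RingHom.id_apply]
  push_cast
  field_simp
  rw [this, ← hr']

theorem IsPosDefOn.sup {A' : Submodule ℂ W} (h : IsPosDefOn c σ B A) (h' : IsPosDefOn c σ B A')
    (h1 : ∀ u ∈ A, ∀ v ∈ A', B u (σ v) = 0) (h2 : ∀ u ∈ A, ∀ v ∈ A', B v (σ u) = 0) :
    IsPosDefOn c σ B (A ⊔ A') := by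
  intro w hw hw0
  obtain ⟨u, hu, v, hv, rfl⟩ := Submodule.mem_sup.1 hw
  have key : c * B (u + v) (σ (u + v)) = c * B u (σ u) + c * B v (σ v) := by
    simp only [map_add, LinearMap.add_apply, h1 u hu v hv, h2 u hu v hv]
    ring
  by_cases hu0 : u = 0
  · subst hu0
    simpa using h' v hv (by simpa using hw0)
  · obtain ⟨r, hr, hr'⟩ := h u hu hu0
    by_cases hv0 : v = 0
    · subst hv0
      exact ⟨r, hr, by simpa using hr'⟩
    · obtain ⟨s, hs, hs'⟩ := h' v hv hv0
      exact ⟨r + s, add_pos hr hs, by rw [key, hr', hs']; push_cast; rfl⟩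

theorem apply_conj_comm {m : ℕ} (hσ : ∀ v, σ (σ v) = v)
    (hsymm : ∀ u v, B u v = (-1) ^ m * B v u)
    (hreal : ∀ u v, B (σ u) (σ v) = starRingEnd ℂ (B u v)) (u v : W) :
    B v (σ u) = (-1) ^ m * starRingEnd ℂ (B u (σ v)) := by
  rw [hsymm, ← hreal, hσ]

variable [FiniteDimensional ℂ W]

theorem IsPosDefOn.exists_orthonormal {m d : ℕ} (h : IsPosDefOn c σ B A) (hσ : ∀ v, σ (σ v) = v)
    (hsymm : ∀ u v, B u v = (-1) ^ m * B v u)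
    (hreal : ∀ u v, B (σ u) (σ v) = starRingEnd ℂ (B u v)) (hd : Module.finrank ℂ A = d) :
    ∃ v : Fin d → W, Submodule.span ℂ (Set.range v) = A ∧
      ∀ i j, c * B (v i) (σ (v j)) = if i = j then 1 else 0 := by
  subst hd
  refine (exists_orthonormal_family (h := fun w => c • B.flip (σ w)) (X := Set.univ)
    (G := (· ≤ A)) (S := A) ?_ ?_ le_rfl).imp fun v hv => hv.2
  · intro S hS hS0
    obtain ⟨u, hu, hu0⟩ := Submodule.exists_mem_ne_zero_of_ne_bot hS0
    obtain ⟨t, ht⟩ := h.exists_smul_eq_one (hS hu) hu0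
    exact ⟨_, S.smul_mem _ hu, trivial, ht, inf_le_left.trans hS⟩
  · intro v w hvw
    simp only [LinearMap.smul_apply, LinearMap.flip_apply, smul_eq_mul, mul_eq_zero] at hvw ⊢
    refine hvw.imp_right fun h0 => ?_
    rw [apply_conj_comm hσ hsymm hreal, h0, map_zero, mul_zero]

theorem IsPosDefOn.exists_real_orthonormal {m d : ℕ} (h : IsPosDefOn c σ B A)
    (hσ : ∀ v, σ (σ v) = v) (hsymm : ∀ u v, B u v = (-1) ^ m * B v u)
    (hreal : ∀ u v, B (σ u) (σ v) = starRingEnd ℂ (B u v)) (hA : ∀ v ∈ A, σ v ∈ A)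
    (hd : Module.finrank ℂ A = d) :
    ∃ v : Fin d → W, (∀ i, σ (v i) = v i) ∧
      Submodule.span ℂ (Set.range v) = A ∧
      ∀ i j, c * B (v i) (v j) = if i = j then 1 else 0 := by
  subst hd
  refine (exists_orthonormal_family (h := fun w => c • B.flip (σ w)) (X := {v | σ v = v})
    (G := fun S => S ≤ A ∧ ∀ v ∈ S, σ v ∈ S) (S := A) ?_ ?_ ⟨le_rfl, hA⟩).imp
    fun v hv => ⟨hv.1, hv.2.1, fun i j => ?_⟩
  · rintro S ⟨hS, hSσ⟩ hS0
    obtain ⟨u, hu, hu0⟩ : ∃ u ∈ S, u ≠ 0 ∧ σ u = u := by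
      obtain ⟨u, hu, hu0⟩ := Submodule.exists_mem_ne_zero_of_ne_bot hS0
      by_cases hne : u + σ u = 0
      · refine ⟨Complex.I • u, S.smul_mem _ hu, by simpa using hu0, ?_⟩
        rw [map_smulₛₗ, eq_neg_of_add_eq_zero_right hne]
        simp
      · exact ⟨u + σ u, S.add_mem hu (hSσ u hu), hne, by rw [map_add, hσ, add_comm]⟩
    obtain ⟨t, ht⟩ := h.exists_smul_eq_one (hS hu) hu0.1
    have hfix : σ ((t : ℂ) • u) = (t : ℂ) • u := by
      rw [map_smulₛₗ, hu0.2, Complex.conj_ofReal]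
    refine ⟨_, S.smul_mem _ hu, hfix, ht, inf_le_left.trans hS, ?_⟩
    rintro v ⟨hvS, hv⟩
    refine ⟨hSσ v hvS, ?_⟩
    simp only [SetLike.mem_coe, LinearMap.mem_ker, LinearMap.smul_apply, LinearMap.flip_apply,
      smul_eq_mul, mul_eq_zero] at hv ⊢
    refine hv.imp_right fun h0 => ?_
    rw [hfix] at h0
    rw [hreal, h0, map_zero]
  · intro v w hvw
    simp only [LinearMap.smul_apply, LinearMap.flip_apply, smul_eq_mul, mul_eq_zero] at hvw ⊢
    refine hvw.imp_right fun h0 => ?_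
    rw [apply_conj_comm hσ hsymm hreal, h0, map_zero, mul_zero]
  · rw [← hv.2.2 i j]
    simp [show σ (v j) = v j from hv.1 j]

end

/-- A conjugation-compatible decomposition `A ⊕ A'` into the positive and negative parts of the
Hermitian form `I ^ (-m) * B u (σ v)`. -/
structure IsSignedDecomp {W : Type*} [AddCommGroup W] [Module ℂ W] (m : ℕ)
    (σ : W →ₛₗ[starRingEnd ℂ] W) (B : W →ₗ[ℂ] W →ₗ[ℂ] ℂ) (A A' : Submodule ℂ W) : Prop where
  conj_conj : ∀ v, σ (σ v) = v
  symm : ∀ u v, B u v = (-1) ^ m * B v u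
  real : ∀ u v, B (σ u) (σ v) = starRingEnd ℂ (B u v)
  orth : ∀ u ∈ A, ∀ v ∈ A', B u (σ v) = 0
  pos : IsPosDefOn (Complex.I ^ (-m : ℤ)) σ B A
  neg : IsPosDefOn (-Complex.I ^ (-m : ℤ)) σ B A'
  conj_even : Even m → (∀ u ∈ A, σ u ∈ A) ∧ ∀ u ∈ A', σ u ∈ A'
  conj_odd : Odd m → (∀ u ∈ A, σ u ∈ A') ∧ ∀ u ∈ A', σ u ∈ A

section

variable {W M : Type*} [AddCommGroup W] [Module ℂ W] [AddCommGroup M] [Module ℂ M]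
  {σ : W →ₛₗ[starRingEnd ℂ] W} {B : W →ₗ[ℂ] W →ₗ[ℂ] ℂ}
  {σM : M →ₛₗ[starRingEnd ℂ] M} {BM : M →ₗ[ℂ] M →ₗ[ℂ] ℂ}

theorem exists_map_of_gram_eq {J : Type*} {v : J → M} {s : J → W} {star : J → J}
    (hspan : ⊤ ≤ Submodule.span ℂ (Set.range v)) (hv : ∀ j, σM (v j) = v (star j))
    (hs : ∀ j, σ (s j) = s (star j)) (hB : ∀ i j, B (s i) (s j) = BM (v i) (v j))
    (h1 : ∀ j, BM (v j) (v (star j)) ≠ 0) (h0 : ∀ i j, i ≠ j → BM (v i) (v (star j)) = 0) :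
    ∃ φ : M →ₗ[ℂ] W, (∀ x, φ (σM x) = σ (φ x)) ∧ (∀ x y, B (φ x) (φ y) = BM x y) ∧
      ∀ x, φ x ∈ Submodule.span ℂ (Set.range s) := by
  have hli : LinearIndependent ℂ v := linearIndependent_of_biorthogonal v
    (fun j => BM.flip (v (star j))) (fun j i hij => h0 i j hij) h1
  let b := Module.Basis.mk hli hspan
  have hb : ∀ j, b j = v j := fun j => by simp [b]
  have hφ : ∀ j, b.constr ℂ s (v j) = s j := fun j => by rw [← hb, Module.Basis.constr_basis]
  refine ⟨b.constr ℂ s, fun x => ?_, fun x y => ?_, fun x => ?_⟩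
  · have : (b.constr ℂ s).comp σM = σ.comp (b.constr ℂ s) :=
      b.ext fun j => by simp [hb, hφ, hv, hs]
    exact LinearMap.congr_fun this x
  · have : B.compl₁₂ (b.constr ℂ s) (b.constr ℂ s) = BM :=
      b.ext fun i => b.ext fun j => by simp [hb, hφ, hB]
    exact LinearMap.congr_fun₂ this x y
  · rw [← Module.Basis.constr_range (S := ℂ) (b := b)]
    exact LinearMap.mem_range_self _ x

namespace IsSignedDecomp

variable {m : ℕ} {A A' : Submodule ℂ W} {AM AM' : Submodule ℂ M}

theorem orth' (h : IsSignedDecomp m σ B A A') {u v : W} (hu : u ∈ A) (hv : v ∈ A') :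
    B v (σ u) = 0 := by
  rw [apply_conj_comm h.conj_conj h.symm h.real, h.orth u hu v hv, map_zero, mul_zero]

variable [FiniteDimensional ℂ W] [FiniteDimensional ℂ M]

/-- Signed decompositions with the same dimensions are isometric. -/
theorem exists_map (hS : IsSignedDecomp m σ B A A') (hM : IsSignedDecomp m σM BM AM AM')
    (hd : Module.finrank ℂ AM = Module.finrank ℂ A)
    (hd' : Module.finrank ℂ AM' = Module.finrank ℂ A') (htop : AM ⊔ AM' = ⊤) :
    ∃ φ : M →ₗ[ℂ] W, (∀ x, φ (σM x) = σ (φ x)) ∧ (∀ x y, B (φ x) (φ y) = BM x y) ∧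
      ∀ x, φ x ∈ A ⊔ A' := by
  have hI : Complex.I ^ (-m : ℤ) ≠ 0 := zpow_ne_zero _ Complex.I_ne_zero
  rcases Nat.even_or_odd m with hm | hm
  · obtain ⟨v, hvσ, hvA, hv⟩ := hS.pos.exists_real_orthonormal hS.conj_conj hS.symm hS.real
      (hS.conj_even hm).1 rfl
    obtain ⟨v', hvσ', hvA', hv'⟩ := hS.neg.exists_real_orthonormal hS.conj_conj hS.symm hS.real
      (hS.conj_even hm).2 rfl
    obtain ⟨w, hwσ, hwA, hw⟩ := hM.pos.exists_real_orthonormal hM.conj_conj hM.symm hM.real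
      (hM.conj_even hm).1 hd
    obtain ⟨w', hwσ', hwA', hw'⟩ := hM.neg.exists_real_orthonormal hM.conj_conj hM.symm hM.real
      (hM.conj_even hm).2 hd'
    have hvm : ∀ i, v i ∈ A := fun i => hvA ▸ Submodule.subset_span ⟨i, rfl⟩
    have hvm' : ∀ i, v' i ∈ A' := fun i => hvA' ▸ Submodule.subset_span ⟨i, rfl⟩
    have hwm : ∀ i, w i ∈ AM := fun i => hwA ▸ Submodule.subset_span ⟨i, rfl⟩
    have hwm' : ∀ i, w' i ∈ AM' := fun i => hwA' ▸ Submodule.subset_span ⟨i, rfl⟩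
    have hv0 : ∀ i j, B (v i) (v' j) = 0 := fun i j => by
      rw [← hvσ' j, hS.orth _ (hvm i) _ (hvm' j)]
    have hv0' : ∀ i j, B (v' i) (v j) = 0 := fun i j => by
      rw [← hvσ j, hS.orth' (hvm j) (hvm' i)]
    have hw0 : ∀ i j, BM (w i) (w' j) = 0 := fun i j => by
      rw [← hwσ' j, hM.orth _ (hwm i) _ (hwm' j)]
    have hw0' : ∀ i j, BM (w' i) (w j) = 0 := fun i j => by
      rw [← hwσ j, hM.orth' (hwm j) (hwm' i)]
    refine (exists_map_of_gram_eq (σ := σ) (B := B) (σM := σM) (BM := BM)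
      (v := Sum.elim w w') (s := Sum.elim v v') (star := id) ?_ ?_ ?_ ?_ ?_ ?_).imp
      fun φ hφ => ⟨hφ.1, hφ.2.1, fun x => ?_⟩
    · rw [Set.Sum.elim_range, Submodule.span_union, hwA, hwA', htop]
    · rintro (i | i)
      · exact hwσ i
      · exact hwσ' i
    · rintro (i | i)
      · exact hvσ i
      · exact hvσ' i
    · rintro (i | i) (j | j)
      · exact mul_left_cancel₀ hI ((hv i j).trans (hw i j).symm)
      · exact (hv0 i j).trans (hw0 i j).symm
      · exact (hv0' i j).trans (hw0' i j).symm
      · exact mul_left_cancel₀ (neg_ne_zero.2 hI) ((hv' i j).trans (hw' i j).symm)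
    · rintro (i | i)
      · exact right_ne_zero_of_mul (a := Complex.I ^ (-m : ℤ)) ((hw i i).trans_ne (by simp))
      · exact right_ne_zero_of_mul (a := -Complex.I ^ (-m : ℤ)) ((hw' i i).trans_ne (by simp))
    · rintro (i | i) (j | j) hij
      · have := hw i j
        rw [if_neg (by simpa using hij)] at this
        exact (mul_eq_zero.1 this).resolve_left hI
      · exact hw0 i j
      · exact hw0' i j
      · have := hw' i j
        rw [if_neg (by simpa using hij)] at this
        exact (mul_eq_zero.1 this).resolve_left (neg_ne_zero.2 hI)
    · have := hφ.2.2 x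
      rwa [Set.Sum.elim_range, Submodule.span_union, hvA, hvA'] at this
  · obtain ⟨v, hvA, hv⟩ := hS.pos.exists_orthonormal hS.conj_conj hS.symm hS.real rfl
    obtain ⟨w, hwA, hw⟩ := hM.pos.exists_orthonormal hM.conj_conj hM.symm hM.real hd
    have hvm : ∀ i, v i ∈ A := fun i => hvA ▸ Submodule.subset_span ⟨i, rfl⟩
    have hwm : ∀ i, w i ∈ AM := fun i => hwA ▸ Submodule.subset_span ⟨i, rfl⟩
    have hv0 : ∀ i j, B (v i) (v j) = 0 := fun i j => by
      rw [← hS.conj_conj (v j), hS.orth _ (hvm i) _ ((hS.conj_odd hm).1 _ (hvm j))]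
    have hw0 : ∀ i j, BM (w i) (w j) = 0 := fun i j => by
      rw [← hM.conj_conj (w j), hM.orth _ (hwm i) _ ((hM.conj_odd hm).1 _ (hwm j))]
    have hv1 : ∀ i j, B (σ (v i)) (v j) = starRingEnd ℂ (B (v i) (σ (v j))) := fun i j => by
      rw [← hS.real, hS.conj_conj]
    have hw1 : ∀ i j, BM (σM (w i)) (w j) = starRingEnd ℂ (BM (w i) (σM (w j))) := fun i j => by
      rw [← hM.real, hM.conj_conj]
    have hvw : ∀ i j, B (v i) (σ (v j)) = BM (w i) (σM (w j)) := fun i j =>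
      mul_left_cancel₀ hI ((hv i j).trans (hw i j).symm)
    refine (exists_map_of_gram_eq (σ := σ) (B := B) (σM := σM) (BM := BM)
      (v := Sum.elim w (σM ∘ w)) (s := Sum.elim v (σ ∘ v)) (star := Sum.swap)
      ?_ ?_ ?_ ?_ ?_ ?_).imp fun φ hφ => ⟨hφ.1, hφ.2.1, fun x =>
        (Submodule.span_le.2 ?_ : Submodule.span ℂ _ ≤ A ⊔ A') (hφ.2.2 x)⟩
    · rw [← htop, sup_le_iff]
      refine ⟨hwA.ge.trans (Submodule.span_mono ?_), fun x hx => ?_⟩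
      · rintro _ ⟨i, rfl⟩
        exact ⟨Sum.inl i, rfl⟩
      · rw [← hM.conj_conj x]
        have hx' := (hM.conj_odd hm).2 x hx
        rw [← hwA] at hx'
        generalize σM x = y at hx'
        induction hx' using Submodule.span_induction with
        | mem y hy =>
          obtain ⟨i, rfl⟩ := hy
          exact Submodule.subset_span ⟨Sum.inr i, rfl⟩
        | zero => simp
        | add y z _ _ hy hz => rw [map_add]; exact add_mem hy hz
        | smul c y _ hy => rw [map_smulₛₗ]; exact Submodule.smul_mem _ _ hy
    · rintro (i | i)
      · rfl
      · exact hM.conj_conj _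
    · rintro (i | i)
      · rfl
      · exact hS.conj_conj _
    · rintro (i | i) (j | j)
      · exact (hv0 i j).trans (hw0 i j).symm
      · exact hvw i j
      · simp [hv1, hw1, hvw]
      · simp [hS.real, hM.real, hv0, hw0]
    · have key : ∀ i, BM (w i) (σM (w i)) ≠ 0 := fun i =>
        right_ne_zero_of_mul (a := Complex.I ^ (-m : ℤ)) ((hw i i).trans_ne (by simp))
      rintro (i | i)
      · exact key i
      · simpa [hw1] using key i
    · have key : ∀ i j, i ≠ j → BM (w i) (σM (w j)) = 0 := fun i j hij => by
        have := hw i j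
        rw [if_neg hij] at this
        exact (mul_eq_zero.1 this).resolve_left hI
      rintro (i | i) (j | j) hij
      · exact key i j (by simpa using hij)
      · exact hw0 i j
      · simp [hM.real, hw0]
      · simpa [hw1] using key i j (by simpa using hij)
    · rintro _ ⟨i | i, rfl⟩
      · exact Submodule.mem_sup_left (hvm i)
      · exact Submodule.mem_sup_right ((hS.conj_odd hm).1 _ (hvm i))

end IsSignedDecomp

end

section

variable {κ : Type*}

/-- The conjugation on `κ → ℂ` permuting coordinates by `bar`. -/
noncomputable def modelConj (bar : κ → κ) : (κ → ℂ) →ₛₗ[starRingEnd ℂ] (κ → ℂ) where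
  toFun v x := starRingEnd ℂ (v (bar x))
  map_add' u v := by ext x; simp
  map_smul' c v := by ext x; simp

/-- The bilinear form on `κ → ℂ` with monomial Gram matrix `g` supported on the graph of `τ`. -/
noncomputable def modelForm [Fintype κ] (g : κ → ℂ) (τ : κ → κ) : (κ → ℂ) →ₗ[ℂ] (κ → ℂ) →ₗ[ℂ] ℂ :=
  LinearMap.mk₂ ℂ (fun u v => ∑ x, g x * u x * v (τ x))
    (fun u u' v => by simp only [Pi.add_apply, ← Finset.sum_add_distrib]; congr! 1; ring)
    (fun c u v => by
      simp only [Pi.smul_apply, smul_eq_mul, Finset.mul_sum]; congr! 1; ring)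
    (fun u v v' => by simp only [Pi.add_apply, ← Finset.sum_add_distrib]; congr! 1; ring)
    (fun c u v => by
      simp only [Pi.smul_apply, smul_eq_mul, Finset.mul_sum]; congr! 1; ring)

@[simp]
theorem modelConj_apply (bar : κ → κ) (v : κ → ℂ) (x : κ) :
    modelConj bar v x = starRingEnd ℂ (v (bar x)) := rfl

theorem modelForm_apply [Fintype κ] (g : κ → ℂ) (τ : κ → κ) (u v : κ → ℂ) :
    modelForm g τ u v = ∑ x, g x * u x * v (τ x) := rfl

/-- The operator `u ↦ (x ↦ η (star x) * u (star x))`. -/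
noncomputable def modelInvolution (η : κ → ℂ) (star : κ → κ) : (κ → ℂ) →ₗ[ℂ] (κ → ℂ) where
  toFun u x := η (star x) * u (star x)
  map_add' u v := by ext x; simp [mul_add]
  map_smul' c v := by ext x; simp only [Pi.smul_apply, smul_eq_mul, RingHom.id_apply]; ring

/-- The eigenspace of `modelInvolution η star` for `ε`. -/
noncomputable def modelPart (η : κ → ℂ) (star : κ → κ) (ε : ℂ) : Submodule ℂ (κ → ℂ) :=
  LinearMap.ker (modelInvolution η star - ε • LinearMap.id)

theorem mem_modelPart {η : κ → ℂ} {star : κ → κ} {ε : ℂ} {u : κ → ℂ} :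
    u ∈ modelPart η star ε ↔ ∀ x, η (star x) * u (star x) = ε * u x := by
  simp [modelPart, modelInvolution, sub_eq_zero, funext_iff]

variable {η : κ → ℂ} {bar star : κ → κ}

theorem modelInvolution_sq (hstar : ∀ x, star (star x) = x)
    (hηstar : ∀ x, η (star x) * η x = 1) (u : κ → ℂ) :
    modelInvolution η star (modelInvolution η star u) = u := by
  ext x
  simp only [modelInvolution, LinearMap.coe_mk, AddHom.coe_mk, hstar]
  rw [← mul_assoc, hηstar, one_mul]

theorem isProj_modelPart (hstar : ∀ x, star (star x) = x)
    (hηstar : ∀ x, η (star x) * η x = 1) {ε : ℂ} (hε : ε * ε = 1) :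
    LinearMap.IsProj (modelPart η star ε)
      ((2 : ℂ)⁻¹ • (LinearMap.id + ε • modelInvolution η star)) where
  map_mem u := by
    simp only [modelPart, LinearMap.mem_ker, LinearMap.sub_apply, LinearMap.smul_apply,
      LinearMap.add_apply, LinearMap.id_apply, map_smul, map_add,
      modelInvolution_sq hstar hηstar]
    have h : ((1 - ε * ε) * 2⁻¹) • modelInvolution η star u = 0 := by simp [hε]
    rw [← h]
    module
  map_id u hu := by
    have hu' : modelInvolution η star u = ε • u := by
      simpa [modelPart, sub_eq_zero] using hu
    simp only [LinearMap.smul_apply, LinearMap.add_apply, LinearMap.id_apply, hu', smul_smul, hε]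
    module

theorem sup_modelPart (hstar : ∀ x, star (star x) = x)
    (hηstar : ∀ x, η (star x) * η x = 1) :
    modelPart η star 1 ⊔ modelPart η star (-1) = ⊤ := by
  refine eq_top_iff.2 fun u _ => ?_
  have h1 := (isProj_modelPart hstar hηstar (ε := 1) (by norm_num)).map_mem u
  have h2 := (isProj_modelPart hstar hηstar (ε := -1) (by norm_num)).map_mem u
  have := Submodule.add_mem_sup h1 h2
  simp only [LinearMap.smul_apply, LinearMap.add_apply, LinearMap.id_apply] at this
  convert this using 1
  module

theorem finrank_modelPart [Fintype κ] [DecidableEq κ] (hstar : ∀ x, star (star x) = x)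
    (hηstar : ∀ x, η (star x) * η x = 1) {ε : ℂ} (hε : ε * ε = 1) :
    (Module.finrank ℂ (modelPart η star ε) : ℂ) =
      (2 : ℂ)⁻¹ * ∑ x, (1 + ε * if star x = x then η x else 0) := by
  rw [← (isProj_modelPart hstar hηstar hε).trace,
    LinearMap.trace_eq_matrix_trace ℂ (Pi.basisFun ℂ κ), Matrix.trace, Finset.mul_sum]
  refine Finset.sum_congr rfl fun x _ => ?_
  simp only [Matrix.diag_apply, LinearMap.toMatrix_apply, Pi.basisFun_apply, Pi.basisFun_repr,
    LinearMap.smul_apply, LinearMap.add_apply, LinearMap.id_apply, Pi.smul_apply, Pi.add_apply,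
    modelInvolution, LinearMap.coe_mk, AddHom.coe_mk, smul_eq_mul, Pi.single_apply]
  by_cases h : star x = x <;> simp [h]

theorem isSignedDecomp_model [Fintype κ] {m : ℕ} (hbar : ∀ x, bar (bar x) = x)
    (hstar : ∀ x, star (star x) = x) (hcomm : ∀ x, bar (star x) = star (bar x))
    (hηstar : ∀ x, η (star x) * η x = 1) (hηconj : ∀ x, starRingEnd ℂ (η x) = η (star x))
    (hηbar : ∀ x, η (bar x) = (-1) ^ m * η (star x)) :
    IsSignedDecomp m (modelConj bar)
      (modelForm (fun x => Complex.I ^ m * η x) (fun x => bar (star x)))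
      (modelPart η star 1) (modelPart η star (-1)) := by
  have hbb : Function.Bijective bar := Function.Involutive.bijective hbar
  have hsb : Function.Bijective star := Function.Involutive.bijective hstar
  have hIm : Complex.I ^ (-m : ℤ) * Complex.I ^ m = 1 := by
    rw [zpow_neg, zpow_natCast, inv_mul_cancel₀ (pow_ne_zero _ Complex.I_ne_zero)]
  have hmm : ((-1 : ℂ) ^ m) * (-1) ^ m = 1 := by rw [← mul_pow]; simp
  have hpart : ∀ {ε : ℂ} {u : κ → ℂ}, u ∈ modelPart η star ε → ∀ x, u (star x) = ε * η x * u x := by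
    intro ε u hu x
    have := mem_modelPart.1 hu x
    linear_combination (-u (star x)) * hηstar x + η x * this
  have hdiag : ∀ {ε : ℂ} {u v : κ → ℂ}, v ∈ modelPart η star ε →
      Complex.I ^ (-m : ℤ) * modelForm (fun x => Complex.I ^ m * η x) (fun x => bar (star x)) u
        (modelConj bar v) = starRingEnd ℂ ε * ∑ x, u x * starRingEnd ℂ (v x) := by
    intro ε u v hv
    rw [modelForm_apply, Finset.mul_sum, Finset.mul_sum]
    refine Finset.sum_congr rfl fun x _ => ?_
    rw [modelConj_apply, hbar, hpart hv, map_mul, map_mul, hηconj]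
    linear_combination (η (star x) * η x * u x * starRingEnd ℂ ε * starRingEnd ℂ (v x)) * hIm +
      (starRingEnd ℂ ε * u x * starRingEnd ℂ (v x)) * hηstar x
  have hnorm : ∀ u : κ → ℂ, u ≠ 0 → 0 < ∑ x, Complex.normSq (u x) := by
    intro u hu
    obtain ⟨x, hx⟩ := Function.ne_iff.1 hu
    exact Finset.sum_pos' (fun y _ => Complex.normSq_nonneg _)
      ⟨x, Finset.mem_univ x, Complex.normSq_pos.2 hx⟩
  have hconj : ∀ {ε ε' : ℂ}, (-1) ^ m * starRingEnd ℂ ε = ε' → ∀ u ∈ modelPart η star ε,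
      modelConj bar u ∈ modelPart η star ε' := by
    intro ε ε' hε u hu
    rw [mem_modelPart]
    intro x
    rw [modelConj_apply, modelConj_apply, hcomm, hpart hu, ← hε, map_mul, map_mul, hηconj,
      ← hcomm, hηbar, hstar]
    linear_combination ((-1) ^ m * starRingEnd ℂ ε * starRingEnd ℂ (u (bar x))) * hηstar x
  refine ⟨fun v => ?_, fun u v => ?_, fun u v => ?_, fun u hu v hv => ?_, fun u hu hu0 => ?_,
    fun u hu hu0 => ?_, fun hm => ⟨hconj ?_, hconj ?_⟩, fun hm => ⟨hconj ?_, hconj ?_⟩⟩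
  · ext x
    simp [hbar]
  · rw [modelForm_apply, modelForm_apply, ← (hbb.comp hsb).sum_comp, Finset.mul_sum]
    refine Finset.sum_congr rfl fun x _ => ?_
    simp only [Function.comp_apply]
    rw [hcomm, hstar, hbar, ← hcomm, hηbar, hstar]
    ring
  · rw [modelForm_apply, modelForm_apply, ← hbb.sum_comp, map_sum]
    refine Finset.sum_congr rfl fun x _ => ?_
    simp only [modelConj_apply, hbar, map_mul, map_pow, Complex.conj_I, hηbar, hηconj]
    rw [hcomm, neg_pow Complex.I]
    ring
  · have h0 : ∑ x, u x * starRingEnd ℂ (v x) = 0 := by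
      refine self_eq_neg.1 ?_
      conv_lhs => rw [← hsb.sum_comp]
      rw [← Finset.sum_neg_distrib]
      refine Finset.sum_congr rfl fun x _ => ?_
      rw [hpart hu, hpart hv, map_mul, map_mul, hηconj]
      simp only [map_neg, map_one]
      linear_combination (-u x * starRingEnd ℂ (v x)) * hηstar x
    have h1 := hdiag (u := u) hv
    rw [h0, mul_zero] at h1
    exact (mul_eq_zero.1 h1).resolve_left (zpow_ne_zero _ Complex.I_ne_zero)
  · refine ⟨_, hnorm u hu0, ?_⟩
    rw [hdiag hu]
    simp [Complex.mul_conj]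
  · refine ⟨_, hnorm u hu0, ?_⟩
    rw [neg_mul, hdiag hu]
    simp [Complex.mul_conj]
  all_goals simp [hm.neg_one_pow]

end

theorem neg_one_zpow_congr {a b : ℤ} (h : Even (a - b)) : (-1 : ℂ) ^ a = (-1) ^ b := by
  rw [show a = (a - b) + b by ring, zpow_add₀ (by norm_num), h.neg_one_zpow, one_mul]

theorem I_zpow_two_mul (a : ℤ) : Complex.I ^ (2 * a) = (-1 : ℂ) ^ a := by
  rw [zpow_mul]
  simp [zpow_ofNat, Complex.I_sq]

section

variable {T : Type*}

/-- The coefficient of the `c`-th vector of a string of length `ℓ` starting in type `p`. -/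
noncomputable def stringSign (p : ℤ) (ℓ c : ℕ) : ℂ := (-1) ^ (p + c) * Complex.I ^ ℓ

theorem stringSign_mul (p : ℤ) {ℓ c : ℕ} (hc : c ≤ ℓ) :
    stringSign p ℓ (ℓ - c) * stringSign p ℓ c = 1 := by
  have h : Complex.I ^ ℓ * Complex.I ^ ℓ = (-1 : ℂ) ^ (ℓ : ℤ) := by
    rw [← mul_pow, Complex.I_mul_I, zpow_natCast]
  rw [stringSign, stringSign, mul_mul_mul_comm, h, ← zpow_add₀ (by norm_num),
    ← zpow_add₀ (by norm_num)]
  refine Even.neg_one_zpow ⟨p + ℓ, ?_⟩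
  push_cast [hc]
  ring

theorem conj_stringSign (p : ℤ) {ℓ c : ℕ} (hc : c ≤ ℓ) :
    starRingEnd ℂ (stringSign p ℓ c) = stringSign p ℓ (ℓ - c) := by
  rw [stringSign, stringSign, map_mul, map_pow, map_zpow₀, Complex.conj_I, neg_pow, map_neg,
    map_one, ← mul_assoc, ← zpow_natCast (-1 : ℂ) ℓ, ← zpow_add₀ (by norm_num)]
  congr 1
  refine neg_one_zpow_congr ⟨c, ?_⟩
  push_cast [hc]
  ring

theorem stringSign_of_add_eq {p r : ℤ} {m ℓ c : ℕ} (hc : c ≤ ℓ) (h : p + r = m + ℓ) :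
    stringSign r ℓ c = (-1) ^ m * stringSign p ℓ (ℓ - c) := by
  rw [stringSign, stringSign, ← mul_assoc, ← zpow_natCast (-1 : ℂ) m, ← zpow_add₀ (by norm_num)]
  congr 1
  refine neg_one_zpow_congr ⟨c - p, ?_⟩
  push_cast [hc]
  linear_combination h

theorem I_pow_mul_stringSign {p r : ℤ} {m ℓ : ℕ} (c : ℕ) (h : p + r = m + ℓ) :
    Complex.I ^ m * stringSign p ℓ c = (-1) ^ c * Complex.I ^ (r - p) := by
  rw [stringSign, show r - p = 2 * (-p) + (m + ℓ) by linear_combination h,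
    zpow_add₀ Complex.I_ne_zero, zpow_add₀ Complex.I_ne_zero, I_zpow_two_mul,
    zpow_add₀ (by norm_num), neg_one_zpow_congr (a := -p) (b := p) ⟨-p, by ring⟩]
  simp only [zpow_natCast]
  ring

theorem sum_stringSign (p : ℤ) (ℓ : ℕ) :
    ∑ c : Fin (ℓ + 1), (if ℓ - (c : ℕ) = c then stringSign p ℓ c else 0) =
      ∑ c : Fin (ℓ + 1), (-1 : ℂ) ^ (p - (c : ℕ) : ℤ) := by
  rw [Fin.sum_univ_eq_sum_range (fun c => if ℓ - c = c then stringSign p ℓ c else 0),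
    Fin.sum_univ_eq_sum_range (fun c => (-1 : ℂ) ^ (p - c : ℤ))]
  have h : ∀ c : ℕ, (-1 : ℂ) ^ (p - c : ℤ) = (-1) ^ p * (-1) ^ c := fun c => by
    rw [← zpow_natCast, ← zpow_add₀ (by norm_num)]
    exact neg_one_zpow_congr ⟨-c, by ring⟩
  simp only [h, ← Finset.mul_sum, neg_one_geom_sum]
  rcases Nat.even_or_odd' ℓ with ⟨s, rfl | rfl⟩
  · rw [Finset.sum_eq_single s]
    · have : (-1 : ℂ) ^ s * (-1) ^ s = 1 := by rw [← mul_pow]; simp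
      rw [if_pos (by omega), if_neg (by simp), stringSign, zpow_add₀ (by norm_num), pow_mul,
        Complex.I_sq, zpow_natCast, mul_assoc, this]
    · intro c hc hcs
      rw [if_neg (by omega)]
    · intro hs
      simp at hs
      omega
  · rw [if_pos ⟨s + 1, by ring⟩, mul_zero]
    exact Finset.sum_eq_zero fun c hc => if_neg (by simp at hc; omega)

/-- The conjugation and the reversal of the vectors of a family of strings. -/
def stringBar {ℓ : T → ℕ} {bar : T → T} (h : ∀ t, ℓ (bar t) = ℓ t)
    (x : (t : T) × Fin (ℓ t + 1)) : (t : T) × Fin (ℓ t + 1) :=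
  ⟨bar x.1, Fin.cast (by rw [h]) x.2⟩

/-- The reversal of the vectors of a family of strings. -/
def stringRev {ℓ : T → ℕ} (x : (t : T) × Fin (ℓ t + 1)) : (t : T) × Fin (ℓ t + 1) :=
  ⟨x.1, Fin.rev x.2⟩

theorem stringRev_val {ℓ : T → ℕ} (x : (t : T) × Fin (ℓ t + 1)) :
    ((stringRev x).2 : ℕ) = ℓ x.1 - x.2 := by
  simp [stringRev, Fin.val_rev]

theorem card_even_string [Fintype T] (ℓ : T → ℕ) (P : T → ℤ) :
    (Nat.card {x : (t : T) × Fin (ℓ t + 1) // Even (P x.1 - (x.2 : ℕ))} : ℂ) =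
      2⁻¹ * ∑ x : (t : T) × Fin (ℓ t + 1), (1 + (-1 : ℂ) ^ (P x.1 - (x.2 : ℕ))) := by
  classical
  rw [Nat.card_eq_fintype_card, Fintype.card_subtype, Finset.mul_sum, Finset.card_filter,
    Nat.cast_sum]
  refine Finset.sum_congr rfl fun x _ => ?_
  rcases Int.even_or_odd (P x.1 - (x.2 : ℕ)) with h | h
  · rw [if_pos h, h.neg_one_zpow]; norm_num
  · rw [if_neg (Int.not_even_iff_odd.2 h), h.neg_one_zpow]; norm_num

theorem card_odd_string [Fintype T] (ℓ : T → ℕ) (P : T → ℤ) :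
    (Nat.card {x : (t : T) × Fin (ℓ t + 1) // Odd (P x.1 - (x.2 : ℕ))} : ℂ) =
      2⁻¹ * ∑ x : (t : T) × Fin (ℓ t + 1), (1 - (-1 : ℂ) ^ (P x.1 - (x.2 : ℕ))) := by
  classical
  rw [Nat.card_eq_fintype_card, Fintype.card_subtype, Finset.mul_sum, Finset.card_filter,
    Nat.cast_sum]
  refine Finset.sum_congr rfl fun x _ => ?_
  rcases Int.even_or_odd (P x.1 - (x.2 : ℕ)) with h | h
  · rw [if_neg (Int.not_odd_iff_even.2 h), h.neg_one_zpow]; norm_num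
  · rw [if_pos h, h.neg_one_zpow]; norm_num

/-- A signed decomposition carries strings of prescribed types, provided that their vectors have
the right number of even and odd types. -/
theorem IsSignedDecomp.exists_strings [Fintype T] {W : Type*} [AddCommGroup W] [Module ℂ W]
    [FiniteDimensional ℂ W] {σ : W →ₛₗ[starRingEnd ℂ] W} {B : W →ₗ[ℂ] W →ₗ[ℂ] ℂ} {m : ℕ}
    {A A' : Submodule ℂ W} (hS : IsSignedDecomp m σ B A A') {ℓ : T → ℕ} {P R : T → ℤ}
    {bar : T → T} (hw : ∀ t, P t + R t = m + ℓ t) (hbar : ∀ t, bar (bar t) = t)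
    (hP : ∀ t, P (bar t) = R t) (hℓ : ∀ t, ℓ (bar t) = ℓ t)
    (hA : Module.finrank ℂ A =
      Nat.card {x : (t : T) × Fin (ℓ t + 1) // Even (P x.1 - (x.2 : ℕ))})
    (hA' : Module.finrank ℂ A' =
      Nat.card {x : (t : T) × Fin (ℓ t + 1) // Odd (P x.1 - (x.2 : ℕ))}) :
    ∃ b : T → ℕ → W, (∀ t c, ℓ t < c → b t c = 0) ∧ (∀ t c, b t c ∈ A ⊔ A') ∧
      (∀ t c, σ (b t c) = b (bar t) c) ∧
      (∀ t t' c c', ¬ (t' = bar t ∧ c + c' = ℓ t) → B (b t c) (b t' c') = 0) ∧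
      ∀ t c c', c + c' = ℓ t → B (b t c) (b (bar t) c') = (-1) ^ c * Complex.I ^ (R t - P t) := by
  classical
  let κ := (t : T) × Fin (ℓ t + 1)
  let η : κ → ℂ := fun x => stringSign (P x.1) (ℓ x.1) x.2
  have hle : ∀ x : κ, (x.2 : ℕ) ≤ ℓ x.1 := fun x => Nat.lt_succ_iff.1 x.2.2
  have hηrev : ∀ x : κ, η (stringRev x) = stringSign (P x.1) (ℓ x.1) (ℓ x.1 - x.2) := fun x => by
    simp only [η, stringRev_val]
    rfl
  have hηstar : ∀ x : κ, η (stringRev x) * η x = 1 := fun x => by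
    rw [hηrev]
    exact stringSign_mul _ (hle x)
  have hrev : ∀ x : κ, stringRev (stringRev x) = x := fun x => by simp [stringRev]
  have hrev' : ∀ x : κ, stringRev x = x ↔ ℓ x.1 - (x.2 : ℕ) = x.2 := fun x => by
    rw [← stringRev_val]
    exact ⟨fun h => by rw [h], fun h => sigma_fin_ext rfl h⟩
  have hbb : ∀ x : κ, stringBar hℓ (stringBar hℓ x) = x := fun x => sigma_fin_ext (hbar _) rfl
  have hM := isSignedDecomp_model (m := m) (η := η) (bar := stringBar hℓ) (star := stringRev) hbb
    hrev (fun x => sigma_fin_ext rfl (by simp [stringBar, stringRev, Fin.val_rev, hℓ]))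
    hηstar
    (fun x => by rw [hηrev]; exact conj_stringSign _ (hle x))
    (fun x => by
      rw [hηrev, ← stringSign_of_add_eq (hle x) (hw x.1)]
      simp [η, stringBar, hP, hℓ])
  have hsum : ∑ x : κ, (if stringRev x = x then η x else 0) =
      ∑ x : κ, (-1 : ℂ) ^ (P x.1 - (x.2 : ℕ)) := by
    rw [Fintype.sum_sigma, Fintype.sum_sigma]
    refine Finset.sum_congr rfl fun t _ => ?_
    refine Eq.trans ?_ (sum_stringSign (P t) (ℓ t))
    simp only [hrev', η]
  obtain ⟨φ, hφσ, hφB, hφA⟩ := hS.exists_map hM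
    (by
      rw [hA, ← Nat.cast_inj (R := ℂ), card_even_string, finrank_modelPart hrev hηstar (by simp)]
      rw [Finset.sum_add_distrib, Finset.sum_add_distrib, ← hsum]
      simp only [one_mul]
      rfl)
    (by
      rw [hA', ← Nat.cast_inj (R := ℂ), card_odd_string, finrank_modelPart hrev hηstar (by simp)]
      rw [Finset.sum_sub_distrib, Finset.sum_add_distrib, ← hsum, sub_eq_add_neg]
      simp only [neg_mul, one_mul, Finset.sum_neg_distrib]
      rfl)
    (sup_modelPart hrev hηstar)
  let e : T → ℕ → κ → ℂ := fun t c x => if x.1 = t ∧ (x.2 : ℕ) = c then 1 else 0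
  have heB : ∀ t c t' c', modelForm (fun x => Complex.I ^ m * η x)
      (fun x => stringBar hℓ (stringRev x)) (e t c) (e t' c') =
      if c ≤ ℓ t ∧ t' = bar t ∧ c + c' = ℓ t then (-1) ^ c * Complex.I ^ (R t - P t) else 0 := by
    intro t c t' c'
    rw [modelForm_apply]
    by_cases hc : c ≤ ℓ t
    · rw [Finset.sum_eq_single (⟨t, c, Nat.lt_succ_of_le hc⟩ : κ)]
      · have h1 : (t' = bar t ∧ c + c' = ℓ t) ↔ (bar t = t' ∧ ℓ t - c = c') := by
          constructor <;> rintro ⟨h, h'⟩ <;> exact ⟨h.symm, by omega⟩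
        have h2 : ((stringBar hℓ (stringRev (⟨t, c, Nat.lt_succ_of_le hc⟩ : κ))).2 : ℕ) = ℓ t - c :=
          stringRev_val _
        have h3 : (stringBar hℓ (stringRev (⟨t, c, Nat.lt_succ_of_le hc⟩ : κ))).1 = bar t := rfl
        simp only [η, I_pow_mul_stringSign _ (hw t)]
        simp [e, hc, h1, h2, h3]
      · intro x _ hx
        have : ¬ (x.1 = t ∧ (x.2 : ℕ) = c) := fun h => hx (sigma_fin_ext h.1 h.2)
        simp [e, this]
      · simp
    · rw [if_neg (fun h => hc h.1)]
      refine Finset.sum_eq_zero fun x _ => ?_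
      have : ¬ (x.1 = t ∧ (x.2 : ℕ) = c) := fun h => hc (by rw [← h.1, ← h.2]; exact hle x)
      simp [e, this]
  refine ⟨fun t c => φ (e t c), fun t c hc => ?_, fun t c => hφA _, fun t c => ?_,
    fun t t' c c' h => ?_, fun t c c' h => ?_⟩
  · have : e t c = 0 := by
      ext x
      refine if_neg fun h => ?_
      have := hle x
      rw [h.2] at this
      rw [h.1] at this
      omega
    simp only [this, map_zero]
  · rw [← hφσ]
    congr 1
    ext x
    have : bar x.1 = t ↔ x.1 = bar t := ⟨fun h => by rw [← h, hbar], fun h => by rw [h, hbar]⟩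
    simp [e, stringBar, this, apply_ite]
  · rw [hφB, heB, if_neg fun h' => h h'.2]
  · rw [hφB, heB, if_pos ⟨by omega, rfl, h⟩]

end

theorem iSupIndep.finrank_iSup {K V ι : Type*} [Field K] [AddCommGroup V] [Module K V]
    [FiniteDimensional K V] {A : ι → Submodule K V} (hA : iSupIndep A) :
    Module.finrank K ↥(⨆ i, A i) = Nat.card ((i : ι) × Fin (Module.finrank K (A i))) := by
  classical
  rw [Submodule.iSup_eq_range_dfinsupp_lsum,
    LinearMap.finrank_range_of_inj hA.dfinsupp_lsum_injective]
  exact Module.finrank_eq_nat_card_basis (DFinsupp.basis fun i => Module.finBasis K (A i))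

theorem iSupIndep.finrank_iSup_subtype {K V ι X : Type*} [Field K] [AddCommGroup V] [Module K V]
    [FiniteDimensional K V] [Finite X] {A : ι → Submodule K V} (hA : iSupIndep A) {τ : X → ι}
    (hτ : ∀ i, Nat.card {x // τ x = i} = Module.finrank K (A i)) (s : ι → Prop) :
    Module.finrank K ↥(⨆ i : {i // s i}, A i) = Nat.card {x // s (τ x)} := by
  refine ((hA.comp (Subtype.val_injective (p := s))).finrank_iSup).trans ?_
  refine Nat.card_congr (Equiv.trans (Equiv.sigmaCongrRight fun i => ?_)
    (Equiv.sigmaSubtypeFiberEquivSubtype τ fun _ => Iff.rfl))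
  exact ((Finite.equivFinOfCardEq (hτ i)).symm)

section

variable {W : Type*} [AddCommGroup W] [Module ℂ W] {σ : W →ₛₗ[starRingEnd ℂ] W}
  {Q : W →ₗ[ℂ] W →ₗ[ℂ] ℂ}

theorem apply_conj_eq_zero_of_mem_iSup {ι κ : Type*} {A : ι → Submodule ℂ W}
    {A' : κ → Submodule ℂ W} (h : ∀ i j, ∀ u ∈ A i, ∀ v ∈ A' j, Q u (σ v) = 0) {u v : W}
    (hu : u ∈ ⨆ i, A i) (hv : v ∈ ⨆ j, A' j) : Q u (σ v) = 0 := by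
  refine Submodule.iSup_induction (motive := fun u => Q u (σ v) = 0) A hu (fun i x hx => ?_)
    (by simp) fun x y hx hy => by rw [map_add, LinearMap.add_apply, hx, hy, add_zero]
  exact Submodule.iSup_induction (motive := fun v => Q x (σ v) = 0) A' hv
    (fun j y hy => h i j x hx y hy) (by simp) fun y z hy hz => by rw [map_add, map_add, hy, hz,
      add_zero]

theorem IsPosDefOn.iSup {ι : Type*} {c : ℂ} {A : ι → Submodule ℂ W}
    (h : ∀ i, IsPosDefOn c σ Q (A i))
    (horth : ∀ i j, i ≠ j → ∀ u ∈ A i, ∀ v ∈ A j, Q u (σ v) = 0) :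
    IsPosDefOn c σ Q (⨆ i, A i) := by
  classical
  have key : ∀ s : Finset ι, IsPosDefOn c σ Q (⨆ i ∈ s, A i) := by
    intro s
    induction s using Finset.induction_on with
    | empty =>
      intro u hu hu0
      exact absurd (by simpa using hu) hu0
    | insert i s hi ih =>
      rw [Finset.iSup_insert]
      rw [iSup_subtype'] at ih ⊢
      refine (h i).sup ih (fun u hu v hv => ?_) fun u hu v hv => ?_
      · exact apply_conj_eq_zero_of_mem_iSup (A := fun _ : Unit => A i)
          (fun _ j => horth _ _ fun hj => hi (hj ▸ j.2)) (by simpa using hu) hv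
      · exact apply_conj_eq_zero_of_mem_iSup (A' := fun _ : Unit => A i)
          (fun j _ => horth _ _ fun hj => hi (hj ▸ j.2)) hv (by simpa using hu)
  intro u hu hu0
  obtain ⟨s, hs⟩ := (Submodule.mem_iSup_iff_exists_finset).1 hu
  exact key s u hs hu0

end

namespace IsRSplitPMHSOn

variable {W : Type*} [AddCommGroup W] [Module ℂ W] {n : ℕ} {σ : W →ₛₗ[starRingEnd ℂ] W}
  {Q : W →ₗ[ℂ] W →ₗ[ℂ] ℂ} {I : ℤ → ℤ → Submodule ℂ W} {N : W →ₗ[ℂ] W}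

/-- The primitive subspaces decompose into parts on which the polarization is definite. -/
theorem isSignedDecomp_primC (h : IsRSplitPMHSOn n ⊤ σ Q I N) (hσ : ∀ v, σ (σ v) = v)
    (hreal : ∀ u v, Q (σ u) (σ v) = starRingEnd ℂ (Q u v))
    (hsymm : ∀ u v, Q u v = (-1) ^ n * Q v u) (k : ℕ) :
    IsSignedDecomp (n + k) σ (Q.compl₂ (N ^ k))
      (⨆ p : {p : ℤ // Even p}, LinearMap.ker (N ^ (k + 1)) ⊓ I p (n + k - p))
      (⨆ p : {p : ℤ // Odd p}, LinearMap.ker (N ^ (k + 1)) ⊓ I p (n + k - p)) := by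
  have hNσ : ∀ a v, (N ^ a) (σ v) = σ ((N ^ a) v) := fun a v =>
    pow_comm_conj h.stable h.comm_conj a v trivial
  have horth : ∀ p r : ℤ, p ≠ r → ∀ u ∈ LinearMap.ker (N ^ (k + 1)) ⊓ I p (n + k - p),
      ∀ v ∈ LinearMap.ker (N ^ (k + 1)) ⊓ I r (n + k - r), Q.compl₂ (N ^ k) u (σ v) = 0 := by
    intro p r hpr u hu v hv
    exact h.orth _ _ _ _ (Or.inl (by omega)) _ hu.2 _
      (h.pow_mem_I k (h.conj_mem_I _ _ _ hv.2))
  have hpos : ∀ p : ℤ, ∀ u ∈ LinearMap.ker (N ^ (k + 1)) ⊓ I p (n + k - p), u ≠ 0 →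
      ∃ r : ℝ, 0 < r ∧ (-1) ^ p * Complex.I ^ (-(n + k : ℕ) : ℤ) *
        Q.compl₂ (N ^ k) u (σ u) = r := by
    intro p u hu hu0
    obtain ⟨r, hr, hr'⟩ := h.pos k p (n + k - p) (by ring) u hu.2 hu.1 hu0
    refine ⟨r, hr, ?_⟩
    rw [← hr', show p - (n + k - p) = 2 * p + (-(n + k : ℕ) : ℤ) by push_cast; ring,
      zpow_add₀ Complex.I_ne_zero, I_zpow_two_mul, LinearMap.compl₂_apply]
  have hconj : ∀ (s s' : ℤ → Prop), (∀ p, s p → s' (n + k - p)) →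
      ∀ u ∈ (⨆ p : {p : ℤ // s p}, LinearMap.ker (N ^ (k + 1)) ⊓ I p (n + k - p)),
      σ u ∈ ⨆ p : {p : ℤ // s' p}, LinearMap.ker (N ^ (k + 1)) ⊓ I p (n + k - p) := by
    intro s s' hs u hu
    refine Submodule.iSup_induction (motive := fun u => σ u ∈ _) _ hu (fun p x hx => ?_)
      (by simp) fun x y hx hy => by rw [map_add]; exact add_mem hx hy
    refine Submodule.mem_iSup_of_mem ⟨n + k - p, hs p p.2⟩ ⟨?_, ?_⟩
    · have hx1 : (N ^ (k + 1)) x = 0 := hx.1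
      rw [SetLike.mem_coe, LinearMap.mem_ker, hNσ, hx1, map_zero]
    · rw [show (n + k - (n + k - p) : ℤ) = p by ring]
      exact h.conj_mem_I _ _ _ hx.2
  have hne : ∀ p r : ℤ, Even p → Odd r → p ≠ r := fun p r hp hr hpr =>
    Int.not_even_iff_odd.2 hr (hpr ▸ hp)
  refine ⟨hσ, fun u v => ?_, fun u v => ?_, fun u hu v hv => ?_, ?_, ?_,
    fun hm => ⟨hconj _ _ fun p hp => ?_, hconj _ _ fun p hp => ?_⟩,
    fun hm => ⟨hconj _ _ fun p hp => ?_, hconj _ _ fun p hp => ?_⟩⟩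
  · rw [LinearMap.compl₂_apply, LinearMap.compl₂_apply, hsymm,
      pow_skew h.stable h.skew k v trivial u trivial, pow_add, mul_assoc]
  · rw [LinearMap.compl₂_apply, LinearMap.compl₂_apply, hNσ, hreal]
  · exact apply_conj_eq_zero_of_mem_iSup (fun p r => horth _ _ (hne _ _ p.2 r.2)) hu hv
  · refine IsPosDefOn.iSup (fun p u hu hu0 => ?_) fun p r hpr => horth _ _ fun h' =>
      hpr (Subtype.ext h')
    simpa [p.2.neg_one_zpow] using hpos p u hu hu0
  · refine IsPosDefOn.iSup (fun p u hu hu0 => ?_) fun p r hpr => horth _ _ fun h' =>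
      hpr (Subtype.ext h')
    simpa [p.2.neg_one_zpow] using hpos p u hu hu0
  all_goals
    simp only [← Int.even_coe_nat, ← Int.odd_coe_nat, Nat.cast_add] at hm
    grind

end IsRSplitPMHSOn

theorem Antitone.existsUnique_lt {g : ℕ → ℕ} (hg : Antitone g) {s : ℕ} (hs : g s = 0) {i : ℕ}
    (hi : i < g 0) : ∃! c, g (c + 1) ≤ i ∧ i < g c := by
  classical
  have hex : ∃ c, g (c + 1) ≤ i := ⟨s, by
    have := hg (Nat.le_succ s)
    simp_all⟩
  have hlt : i < g (Nat.find hex) := by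
    rcases h : Nat.find hex with _ | c
    · exact hi
    · exact not_le.1 (Nat.find_min hex (by omega : c < Nat.find hex))
  refine ⟨Nat.find hex, ⟨Nat.find_spec hex, hlt⟩, fun c hc => ?_⟩
  refine le_antisymm ?_ (Nat.find_min' hex hc.1)
  by_contra! h
  have := hg (Nat.succ_le_of_lt h)
  exact absurd (hc.2.trans_le this) (not_lt.2 (Nat.find_spec hex))

/-- The strings of a Hodge diamond `f` of weight `m`: those starting in type `(p, q)` are indexed
by the `i` with `f (p + 1) (q + 1) ≤ i < f p q`. -/
def StringTop (m : ℤ) (f : ℤ → ℤ → ℕ) : Type :=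
  {x : ℤ × ℤ × ℕ // m ≤ x.1 + x.2.1 ∧ f (x.1 + 1) (x.2.1 + 1) ≤ x.2.2 ∧ x.2.2 < f x.1 x.2.1}

/-- The axioms of a Hodge diamond of weight `m`, apart from the Hodge numbers. -/
structure IsHodgeDiamond (m : ℤ) (f : ℤ → ℤ → ℕ) : Prop where
  finite : {x : ℤ × ℤ | f x.1 x.2 ≠ 0}.Finite
  swap : ∀ p q, f p q = f q p
  dual : ∀ p q, f p q = f (m - q) (m - p)
  le : ∀ p q, p + q ≤ m → f (p - 1) (q - 1) ≤ f p q

namespace StringTop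

variable {m : ℤ} {f : ℤ → ℤ → ℕ}

/-- The first index of the type of the top of the string. -/
def left (t : StringTop m f) : ℤ := t.1.1

/-- The second index of the type of the top of the string. -/
def right (t : StringTop m f) : ℤ := t.1.2.1

/-- The length of the string, minus one. -/
def len (t : StringTop m f) : ℕ := (t.left + t.right - m).toNat

theorem left_add_right (t : StringTop m f) : t.left + t.right = m + t.len := by
  have := t.2.1
  simp only [len, left, right]
  omega

/-- The conjugate string. -/
def bar (hf : IsHodgeDiamond m f) (t : StringTop m f) : StringTop m f :=
  ⟨(t.1.2.1, t.1.1, t.1.2.2), by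
    rw [add_comm, hf.swap t.1.2.1, hf.swap (t.1.2.1 + 1)]
    exact t.2⟩

theorem bar_bar (hf : IsHodgeDiamond m f) (t : StringTop m f) : (t.bar hf).bar hf = t := rfl

theorem len_bar (hf : IsHodgeDiamond m f) (t : StringTop m f) : (t.bar hf).len = t.len := by
  simp only [len, left, right, bar, add_comm]

theorem finite (hf : IsHodgeDiamond m f) : Finite (StringTop m f) := by
  have := hf.finite.to_subtype
  refine Finite.of_injective (fun t : StringTop m f =>
    (⟨⟨(t.1.1, t.1.2.1), (pos_of_gt t.2.2.2).ne'⟩, ⟨t.1.2.2, t.2.2.2⟩⟩ :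
      (x : {x : ℤ × ℤ | f x.1 x.2 ≠ 0}) × Fin (f x.1.1 x.1.2))) fun t t' h => ?_
  have h1 := congrArg (fun x => (x.1.1.1, x.1.1.2, (x.2 : ℕ))) h
  exact Subtype.ext h1

end StringTop

namespace IsHodgeDiamond

open StringTop

variable {m : ℤ} {f : ℤ → ℤ → ℕ}

theorem antitone (hf : IsHodgeDiamond m f) {p q : ℤ} (h : m ≤ p + q) :
    Antitone fun c : ℕ => f (p + c) (q + c) := by
  refine antitone_nat_of_succ_le fun c => ?_
  rw [hf.dual, hf.dual (p + c)]
  refine le_of_eq_of_le ?_ (hf.le (m - (q + c)) (m - (p + c)) (by omega))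
  congr 1 <;> push_cast <;> ring

theorem exists_eq_zero (hf : IsHodgeDiamond m f) (p q : ℤ) : ∃ c : ℕ, f (p + c) (q + c) = 0 := by
  by_contra! h
  refine Set.infinite_univ (α := ℕ) ((hf.finite.preimage (f := fun c : ℕ => (p + c, q + c))
    fun c _ c' _ hc => ?_).subset fun c _ => h c)
  have := congrArg Prod.fst hc
  simpa using this

theorem card_string (hf : IsHodgeDiamond m f) (p q : ℤ) :
    Nat.card {x : (t : StringTop m f) × Fin (t.len + 1) //
      x.1.left - (x.2 : ℕ) = p ∧ x.1.right - (x.2 : ℕ) = q} = f p q := by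
  obtain ⟨c₀, hc₀, hc₁, hc₂⟩ : ∃ c₀ : ℕ, m ≤ (p + c₀) + (q + c₀) ∧ f (p + c₀) (q + c₀) = f p q ∧
      ∀ c : ℕ, m - p - q ≤ c ↔ c₀ ≤ c := by
    rcases le_total m (p + q) with h | h
    · exact ⟨0, by simpa, by simp, fun c => by omega⟩
    · refine ⟨(m - p - q).toNat, by omega, ?_, fun c => by omega⟩
      rw [hf.dual p q]
      congr 1 <;> omega
  have hg := hf.antitone hc₀
  have hg0 : f (p + c₀ + (0 : ℕ)) (q + c₀ + (0 : ℕ)) = f p q := by simpa using hc₁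
  have hspec : ∀ x : (t : StringTop m f) × Fin (t.len + 1), x.1.left - (x.2 : ℕ) = p →
      x.1.right - (x.2 : ℕ) = q → ∃ c : ℕ, (x.2 : ℕ) = c₀ + c ∧ x.1.left = p + c₀ + c ∧
        x.1.right = q + c₀ + c ∧ f (p + c₀ + (c + 1 : ℕ)) (q + c₀ + (c + 1 : ℕ)) ≤ x.1.1.2.2 ∧
        x.1.1.2.2 < f (p + c₀ + c) (q + c₀ + c) := by
    intro x hp hq
    have h1 := (hc₂ x.2).1 (by
      have := x.1.left_add_right
      have := x.2.2
      omega)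
    refine ⟨x.2 - c₀, by omega, by omega, by omega, ?_, ?_⟩
    · convert x.1.2.2.1 using 2 <;> simp only [left, right] at hp hq <;> push_cast [h1] <;> omega
    · convert x.1.2.2.2 using 2 <;> simp only [left, right] at hp hq <;> push_cast [h1] <;> omega
  obtain ⟨s, hs⟩ := hf.exists_eq_zero (p + c₀) (q + c₀)
  refine (Nat.card_eq_of_bijective (fun x => (⟨x.1.1.1.2.2, ?_⟩ : Fin (f p q))) ⟨?_, ?_⟩).trans
    (Nat.card_fin _)
  · obtain ⟨c, -, -, -, -, hc⟩ := hspec x.1 x.2.1 x.2.2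
    exact hc.trans_le (hg0 ▸ hg (Nat.zero_le c))
  · rintro ⟨x, hx⟩ ⟨y, hy⟩ hxy
    have hxy : x.1.1.2.2 = y.1.1.2.2 := congrArg Fin.val hxy
    obtain ⟨c, h1, h2, h3, h4, h5⟩ := hspec x hx.1 hx.2
    obtain ⟨c', h1', h2', h3', h4', h5'⟩ := hspec y hy.1 hy.2
    obtain rfl : c = c' := (hg.existsUnique_lt hs ((h5.trans_le (hg (Nat.zero_le c))))).unique
      ⟨h4, h5⟩ ⟨hxy ▸ h4', hxy ▸ h5'⟩
    refine Subtype.ext (sigma_fin_ext (Subtype.ext ?_) (h1.trans h1'.symm))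
    exact Prod.ext (h2.trans h2'.symm) (Prod.ext (h3.trans h3'.symm) hxy)
  · intro i
    obtain ⟨c, ⟨h1, h2⟩, -⟩ := hg.existsUnique_lt hs (i := i)
      (i.2.trans_eq hg0.symm)
    let t : StringTop m f := ⟨(p + c₀ + c, q + c₀ + c, i), by simp only; omega, by
      convert h1 using 2 <;> push_cast <;> ring, h2⟩
    have hl : c₀ + c < t.len + 1 := by
      have := (hc₂ (c₀ + c)).2 (by omega)
      have : t.left + t.right - m = p + c₀ + c + (q + c₀ + c) - m := rfl
      rw [len, this]
      omega
    exact ⟨⟨⟨t, c₀ + c, hl⟩, by simp [t, left, add_assoc], by simp [t, right, add_assoc]⟩, rfl⟩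

theorem card_string_left (hf : IsHodgeDiamond m f) {p : ℤ} {s : Finset ℤ}
    (hs : ∀ q, f p q ≠ 0 → q ∈ s) :
    Nat.card {x : (t : StringTop m f) × Fin (t.len + 1) // x.1.left - (x.2 : ℕ) = p} =
      ∑ q ∈ s, f p q := by
  classical
  have := StringTop.finite hf
  have := Fintype.ofFinite (StringTop m f)
  have hmem : ∀ x ∈ ({x | x.1.left - (x.2 : ℕ) = p} :
      Finset ((t : StringTop m f) × Fin (t.len + 1))), x.1.right - (x.2 : ℕ) ∈ s := by
    intro x hx
    refine hs _ ?_
    rw [← hf.card_string, Nat.card_ne_zero]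
    exact ⟨⟨⟨x, by simpa using hx, rfl⟩⟩, inferInstance⟩
  rw [Nat.card_eq_fintype_card, Fintype.card_subtype, Finset.card_eq_sum_card_fiberwise hmem]
  refine Finset.sum_congr rfl fun q _ => ?_
  rw [← hf.card_string, Nat.card_eq_fintype_card, Fintype.card_subtype, Finset.filter_filter]

end IsHodgeDiamond

theorem primNum_eq {W : Type*} [AddCommGroup W] [Module ℂ W] {n : ℤ}
    {I : ℤ → ℤ → Submodule ℂ W} {N : W →ₗ[ℂ] W} (k : ℕ) (p : ℤ) :
    primNum n I N p (n + k - p) =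
      Module.finrank ℂ ↥(LinearMap.ker (N ^ (k + 1)) ⊓ I p (n + k - p)) := by
  rw [primNum, show (p + (n + k - p) - n).toNat = k by omega]

namespace IsRSplitPMHSOn

variable {W : Type*} [AddCommGroup W] [Module ℂ W] {n : ℤ} {S : Submodule ℂ W}
  {σ : W →ₛₗ[starRingEnd ℂ] W} {Q : W →ₗ[ℂ] W →ₗ[ℂ] ℂ} {I : ℤ → ℤ → Submodule ℂ W}
  {N : W →ₗ[ℂ] W}

theorem indep_primitive (h : IsRSplitPMHSOn n S σ Q I N) (k : ℕ) :
    iSupIndep fun p : ℤ => LinearMap.ker (N ^ (k + 1)) ⊓ I p (n + k - p) :=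
  (h.indep.comp (f := fun p : ℤ => (p, n + k - p)) fun _ _ hp => congrArg Prod.fst hp).mono
    fun _ => inf_le_right

variable [FiniteDimensional ℂ W]

theorem isHodgeDiamond (h : IsRSplitPMHSOn n S σ Q I N) {k : ℕ} {f : ℤ → ℤ → ℕ}
    (hfa : ∀ p : ℤ, ∃ s : Finset ℤ, (∀ q : ℤ, f p q ≠ 0 → q ∈ s) ∧
      ∑ q ∈ s, f p q = primNum n I N p (n + k - p))
    (hfb : ∀ p q : ℤ, f p q = f q p ∧ f p q = f (n + k - q) (n + k - p))
    (hfc : ∀ p q : ℤ, p + q ≤ n + k → f (p - 1) (q - 1) ≤ f p q) :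
    IsHodgeDiamond (n + k) f where
  finite := by
    choose s hs hsum using hfa
    refine ((WellFoundedGT.finite_ne_bot_of_iSupIndep (h.indep_primitive k)).biUnion
      (t := fun p => (fun q => (p, q)) '' (s p : Set ℤ)) fun p _ =>
        (s p).finite_toSet.image _).subset fun x hx => ?_
    refine Set.mem_biUnion (x := x.1) ?_ ⟨x.2, hs _ _ hx, rfl⟩
    intro h0
    have h1 := hsum x.1
    rw [primNum_eq, h0, finrank_bot, Finset.sum_eq_zero_iff] at h1
    exact hx (h1 _ (hs _ _ hx))
  swap p q := (hfb p q).1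
  dual p q := (hfb p q).2
  le := hfc

theorem card_string_left (h : IsRSplitPMHSOn n S σ Q I N) {k : ℕ} {f : ℤ → ℤ → ℕ}
    (hf : IsHodgeDiamond (n + k) f)
    (hfa : ∀ p : ℤ, ∃ s : Finset ℤ, (∀ q : ℤ, f p q ≠ 0 → q ∈ s) ∧
      ∑ q ∈ s, f p q = primNum n I N p (n + k - p)) (s : ℤ → Prop) :
    Module.finrank ℂ ↥(⨆ p : {p : ℤ // s p}, LinearMap.ker (N ^ (k + 1)) ⊓ I p (n + k - p)) =
      Nat.card {x : (t : StringTop (n + k) f) × Fin (t.len + 1) // s (x.1.left - (x.2 : ℕ))} := by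
  have := StringTop.finite hf
  refine (h.indep_primitive k).finrank_iSup_subtype
    (τ := fun x : (t : StringTop (n + k) f) × Fin (t.len + 1) => x.1.left - (x.2 : ℕ))
    (fun p => ?_) s
  obtain ⟨s, hs, hsum⟩ := hfa p
  rw [hf.card_string_left hs, hsum, primNum_eq]

theorem finrank_primC (h : IsRSplitPMHSOn n S σ Q I N) {k : ℕ} {f : ℤ → ℤ → ℕ}
    (hf : IsHodgeDiamond (n + k) f)
    (hfa : ∀ p : ℤ, ∃ s : Finset ℤ, (∀ q : ℤ, f p q ≠ 0 → q ∈ s) ∧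
      ∑ q ∈ s, f p q = primNum n I N p (n + k - p)) :
    Module.finrank ℂ (primC n I N k) =
      Nat.card ((t : StringTop (n + k) f) × Fin (t.len + 1)) := by
  have := h.card_string_left hf hfa fun _ => True
  rw [Nat.card_congr (Equiv.subtypeUnivEquiv fun _ => trivial)] at this
  rw [← this, primC, ← Equiv.iSup_comp (Equiv.subtypeUnivEquiv fun _ => trivial)]
  rfl

end IsRSplitPMHSOn

/-- Strings `b t` in the primitive subspace of weight `n + k`, of the types prescribed by `f`, with
monomial Gram matrix. -/
structure IsPrimitiveStrings {W : Type*} [AddCommGroup W] [Module ℂ W] (n : ℤ)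
    (σ : W →ₛₗ[starRingEnd ℂ] W) (Q : W →ₗ[ℂ] W →ₗ[ℂ] ℂ) (I : ℤ → ℤ → Submodule ℂ W)
    (N : W →ₗ[ℂ] W) (k : ℕ) {f : ℤ → ℤ → ℕ} (hf : IsHodgeDiamond (n + k) f)
    (b : StringTop (n + k) f → ℕ → W) : Prop where
  eq_zero : ∀ t c, t.len < c → b t c = 0
  mem : ∀ t c, b t c ∈ primC n I N k
  conj : ∀ t c, σ (b t c) = b (t.bar hf) c
  orth : ∀ t t' c c', ¬ (t' = t.bar hf ∧ c + c' = t.len) → Q (b t c) ((N ^ k) (b t' c')) = 0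
  pairing : ∀ t c c', c + c' = t.len →
    Q (b t c) ((N ^ k) (b (t.bar hf) c')) = (-1) ^ c * Complex.I ^ (t.right - t.left)
  finrank_eq : Module.finrank ℂ (primC n I N k) =
    Nat.card ((t : StringTop (n + k) f) × Fin (t.len + 1))

/-- The primitive subspace of weight `n + k` is spanned by strings as prescribed by `f`. -/
theorem IsRSplitPMHSOn.exists_strings_primC {W : Type*} [AddCommGroup W] [Module ℂ W]
    [FiniteDimensional ℂ W] {n : ℕ} {σ : W →ₛₗ[starRingEnd ℂ] W} {Q : W →ₗ[ℂ] W →ₗ[ℂ] ℂ}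
    {I : ℤ → ℤ → Submodule ℂ W} {N : W →ₗ[ℂ] W} (h : IsRSplitPMHSOn n ⊤ σ Q I N)
    (hσ : ∀ v, σ (σ v) = v) (hreal : ∀ u v, Q (σ u) (σ v) = starRingEnd ℂ (Q u v))
    (hsymm : ∀ u v, Q u v = (-1) ^ n * Q v u) {k : ℕ} {f : ℤ → ℤ → ℕ}
    (hf : IsHodgeDiamond (n + k) f)
    (hfa : ∀ p : ℤ, ∃ s : Finset ℤ, (∀ q : ℤ, f p q ≠ 0 → q ∈ s) ∧
      ∑ q ∈ s, f p q = primNum n I N p (n + k - p)) :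
    ∃ b, IsPrimitiveStrings n σ Q I N k hf b := by
  have := StringTop.finite hf
  have := Fintype.ofFinite (StringTop (n + k) f)
  refine ((h.isSignedDecomp_primC hσ hreal hsymm k).exists_strings (bar := StringTop.bar hf)
    (ℓ := StringTop.len) (fun t => ?_) (StringTop.bar_bar hf) (fun t => rfl)
    (StringTop.len_bar hf) (h.card_string_left hf hfa _) (h.card_string_left hf hfa _)).imp
    fun b hb => ⟨hb.1, fun t c => ?_, hb.2.2.1, hb.2.2.2.1, hb.2.2.2.2, h.finrank_primC hf hfa⟩
  · push_cast
    exact t.left_add_right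
  · refine (sup_le ?_ ?_ : _ ≤ primC n I N k) (hb.2.1 t c) <;>
    exact iSup_le fun p => le_iSup (fun p => LinearMap.ker (N ^ (k + 1)) ⊓ I p (n + k - p)) p.1

namespace IsPrimitiveStrings

variable {W : Type*} [AddCommGroup W] [Module ℂ W] {n : ℤ} {σ : W →ₛₗ[starRingEnd ℂ] W}
  {Q : W →ₗ[ℂ] W →ₗ[ℂ] ℂ} {I : ℤ → ℤ → Submodule ℂ W} {N : W →ₗ[ℂ] W} {k : ℕ}
  {f : ℤ → ℤ → ℕ} {hf : IsHodgeDiamond (n + k) f} {b : StringTop (n + k) f → ℕ → W}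

theorem linearIndependent (hb : IsPrimitiveStrings n σ Q I N k hf b) :
    LinearIndependent ℂ fun x : (t : StringTop (n + k) f) × Fin (t.len + 1) => b x.1 x.2 := by
  refine linearIndependent_of_biorthogonal _
    (fun x => Q.flip ((N ^ k) (b (x.1.bar hf) (x.1.len - x.2)))) (fun x y hxy => ?_) fun x => ?_
  · refine hb.orth _ _ _ _ fun h => hxy ?_
    have h1 : y.1 = x.1 := (congrArg (StringTop.bar hf) h.1).symm
    have h2 := h.2
    have h3 := congrArg StringTop.len h1
    exact sigma_fin_ext h1 (by have := x.2.2; have := y.2.2; omega)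
  · rw [LinearMap.flip_apply, hb.pairing _ _ _ (by have := x.2.2; omega)]
    exact mul_ne_zero (by simp) (zpow_ne_zero _ Complex.I_ne_zero)

theorem span_eq [FiniteDimensional ℂ W] (hb : IsPrimitiveStrings n σ Q I N k hf b) :
    Submodule.span ℂ (Set.range fun x : (t : StringTop (n + k) f) × Fin (t.len + 1) =>
      b x.1 x.2) = primC n I N k := by
  have := StringTop.finite hf
  have := Fintype.ofFinite (StringTop (n + k) f)
  refine span_range_eq_of_card hb.linearIndependent (fun x => hb.mem _ _) ?_
  rw [hb.finrank_eq, Nat.card_eq_fintype_card]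

/-- The span of the vectors of type `(p, q)` of the strings. -/
def part (b : StringTop (n + k) f → ℕ → W) (p q : ℤ) : Submodule ℂ W :=
  Submodule.span ℂ ((fun x : (t : StringTop (n + k) f) × Fin (t.len + 1) => b x.1 x.2) ''
    {x | (x.1.left - (x.2 : ℕ), x.1.right - (x.2 : ℕ)) = (p, q)})

theorem finrank_part (hb : IsPrimitiveStrings n σ Q I N k hf b) (p q : ℤ) :
    Module.finrank ℂ (part b p q) = f p q := by
  have := StringTop.finite hf
  rw [part, hb.linearIndependent.finrank_span_image, ← hf.card_string]
  simp only [Prod.mk.injEq, Set.coe_ofPred]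

theorem map_mem [FiniteDimensional ℂ W] (hb : IsPrimitiveStrings n σ Q I N k hf b)
    {N' : W →ₗ[ℂ] W} (hN' : ∀ t c, N' (b t c) = b t (c + 1)) {v : W} (hv : v ∈ primC n I N k) :
    N' v ∈ primC n I N k := by
  rw [← hb.span_eq] at hv
  refine (Submodule.span_le (p := (primC n I N k).comap N')).2 ?_ hv
  rintro _ ⟨x, rfl⟩
  simpa only [SetLike.mem_coe, Submodule.mem_comap, hN'] using hb.mem _ _

theorem pow_apply {b : StringTop (n + k) f → ℕ → W} {N' : W →ₗ[ℂ] W}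
    (hN' : ∀ t c, N' (b t c) = b t (c + 1)) (t : StringTop (n + k) f) (a : ℕ) :
    (N' ^ a) (b t 0) = b t a := by
  induction a with
  | zero => simp
  | succ a ih => rw [pow_succ', Module.End.mul_apply, ih, hN']

theorem isStringFamily [FiniteDimensional ℂ W] [Fintype (StringTop (n + k) f)]
    (hb : IsPrimitiveStrings n σ Q I N k hf b) (h : IsRSplitPMHSOn n ⊤ σ Q I N)
    {N' : W →ₗ[ℂ] W} (hN' : ∀ t c, N' (b t c) = b t (c + 1))
    (hskew : ∀ u v, Q (N' u) v + Q u (N' v) = 0) (hσ : ∀ v, N' (σ v) = σ (N' v))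
    (hcomm : Commute N N') :
    IsStringFamily (n + k) (primC n I N k) σ (Q.compl₂ (N ^ k)) (part b) N'
      StringTop.len StringTop.left StringTop.right (StringTop.bar hf) (fun t => b t 0) where
  weight t := t.left_add_right
  bar_bar := StringTop.bar_bar hf
  P_bar t := rfl
  pow_eq_zero t := by rw [pow_apply hN', hb.eq_zero _ _ (Nat.lt_succ_self _)]
  mem t := hb.mem _ _
  stable v hv := hb.map_mem hN' hv
  conj_mem v hv := h.conj_mem_primC hv
  skew u hu v hv := by
    rw [LinearMap.compl₂_apply, LinearMap.compl₂_apply, ← hskew u ((N ^ k) v),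
      ← Module.End.mul_apply, ← Module.End.mul_apply, (hcomm.pow_left k).eq]
  comm_conj v hv := hσ v
  conj_e t := hb.conj _ _
  indep := hb.linearIndependent.iSupIndep_span_image _
  le p q := by
    refine Submodule.span_le.2 ?_
    rintro _ ⟨x, -, rfl⟩
    exact hb.mem _ _
  mem_I t a ha := by
    rw [pow_apply hN']
    exact Submodule.subset_span ⟨⟨t, a, Nat.lt_succ_of_le ha⟩, rfl, rfl⟩
  orth t t' a hta := by
    rw [LinearMap.compl₂_apply, pow_apply hN', hb.orth _ _ _ _ (by simpa using hta)]
  pos t := ⟨1, one_pos, by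
    rw [LinearMap.compl₂_apply, pow_apply hN', hb.pairing _ _ _ (zero_add _), pow_zero, one_mul,
      ← zpow_add₀ Complex.I_ne_zero]
    simp⟩
  card := by
    rw [hb.finrank_eq, Nat.card_eq_fintype_card, Fintype.card_sigma]
    simp

/-- The shift of the strings is an ℝ-split polarized mixed Hodge structure. -/
theorem isRSplitPMHSOn [FiniteDimensional ℂ W] (hb : IsPrimitiveStrings n σ Q I N k hf b)
    (h : IsRSplitPMHSOn n ⊤ σ Q I N) {N' : W →ₗ[ℂ] W} (hN' : ∀ t c, N' (b t c) = b t (c + 1))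
    (hskew : ∀ u v, Q (N' u) v + Q u (N' v) = 0) (hσ : ∀ v, N' (σ v) = σ (N' v))
    (hcomm : Commute N N') :
    IsRSplitPMHSOn (n + k) (primC n I N k) σ (Q.compl₂ (N ^ k)) (part b) N' := by
  have := StringTop.finite hf
  have := Fintype.ofFinite (StringTop (n + k) f)
  exact (hb.isStringFamily h hN' hskew hσ hcomm).isRSplitPMHSOn

end IsPrimitiveStrings

/-- The strings in all the primitive subspaces. -/
abbrev PrimitiveStringTop (n : ℤ) (f : ℕ → ℤ → ℤ → ℕ) : Type :=
  (k : ℕ) × StringTop (n + k) (f k)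

/-- The vectors obtained from strings in the primitive subspaces by applying powers of `N`. -/
def primitiveGrid {W : Type*} [AddCommGroup W] [Module ℂ W] {n : ℤ} {f : ℕ → ℤ → ℤ → ℕ}
    (N : W →ₗ[ℂ] W) (b : ∀ k : ℕ, StringTop (n + k) (f k) → ℕ → W) (t : PrimitiveStringTop n f)
    (c a : ℕ) : W :=
  (N ^ a) (b t.1 t.2 c)

/-- The index type of a basis formed by the vectors of a `primitiveGrid`. -/
abbrev GridIndex (n : ℤ) (f : ℕ → ℤ → ℤ → ℕ) : Type :=
  (t : PrimitiveStringTop n f) × (Fin (t.2.len + 1) × Fin (t.1 + 1))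

namespace PrimitiveStringTop

variable {n : ℤ} {f : ℕ → ℤ → ℤ → ℕ}

/-- The conjugate string. -/
def bar (hf : ∀ k : ℕ, IsHodgeDiamond (n + k) (f k)) (t : PrimitiveStringTop n f) :
    PrimitiveStringTop n f :=
  ⟨t.1, t.2.bar (hf t.1)⟩

theorem isEmpty_of_eq_zero {k : ℕ} (h : ∀ p q, f k p q = 0) : IsEmpty (StringTop (n + k) (f k)) :=
  ⟨fun t => absurd t.2.2.2 (by simp [h])⟩

theorem lt_of_eq_zero {K : ℕ} (hK : ∀ k, K ≤ k → ∀ p q, f k p q = 0)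
    (t : PrimitiveStringTop n f) : t.1 < K :=
  not_le.1 fun h => (isEmpty_of_eq_zero (n := n) (hK _ h)).false t.2

theorem finite (hf : ∀ k : ℕ, IsHodgeDiamond (n + k) (f k)) {K : ℕ}
    (hK : ∀ k, K ≤ k → ∀ p q, f k p q = 0) : Finite (PrimitiveStringTop n f) := by
  have := fun k => StringTop.finite (hf k)
  refine Finite.of_surjective
    (fun x : (k : Fin K) × StringTop (n + (k : ℕ)) (f k) => (⟨x.1, x.2⟩ : PrimitiveStringTop n f))
    fun t => ⟨⟨⟨t.1, lt_of_eq_zero hK t⟩, t.2⟩, rfl⟩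

end PrimitiveStringTop

theorem GridIndex.ext {n : ℤ} {f : ℕ → ℤ → ℤ → ℕ} {x y : GridIndex n f} (h1 : x.1 = y.1)
    (h2 : (x.2.1 : ℕ) = y.2.1) (h3 : (x.2.2 : ℕ) = y.2.2) : x = y := by
  obtain ⟨t, c, a⟩ := x
  obtain ⟨t', c', a'⟩ := y
  obtain rfl : t = t' := h1
  exact congrArg (Sigma.mk t) (Prod.ext (Fin.ext h2) (Fin.ext h3))

theorem GridIndex.card_type {n : ℤ} {f : ℕ → ℤ → ℤ → ℕ}
    (hf : ∀ k : ℕ, IsHodgeDiamond (n + k) (f k)) {K : ℕ} (hK : ∀ k, K ≤ k → ∀ p q, f k p q = 0)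
    (p q : ℤ) :
    Nat.card {x : GridIndex n f | (x.1.2.left - (x.2.1 : ℕ) - (x.2.2 : ℕ),
      x.1.2.right - (x.2.1 : ℕ) - (x.2.2 : ℕ)) = (p, q)} =
    ∑ᶠ k : ℕ, ∑ a ∈ Finset.range (k + 1), f k (p + a) (q + a) := by
  have := fun k => StringTop.finite (hf k)
  rw [finsum_eq_sum_of_support_subset (s := Finset.range K), Finset.sum_range]
  · let e : {x : GridIndex n f | (x.1.2.left - (x.2.1 : ℕ) - (x.2.2 : ℕ),
        x.1.2.right - (x.2.1 : ℕ) - (x.2.2 : ℕ)) = (p, q)} ≃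
        ((k : Fin K) × (a : Fin ((k : ℕ) + 1)) ×
          {x : (t : StringTop (n + (k : ℕ)) (f k)) × Fin (t.len + 1) //
            x.1.left - (x.2 : ℕ) = p + (a : ℕ) ∧ x.1.right - (x.2 : ℕ) = q + (a : ℕ)}) :=
      { toFun := fun x => ⟨⟨x.1.1.1, x.1.1.lt_of_eq_zero hK⟩, x.1.2.2, ⟨x.1.1.2, x.1.2.1⟩, by
          have := Prod.ext_iff.1 x.2
          simp only at this ⊢
          omega⟩
        invFun := fun y => ⟨⟨⟨y.1, y.2.2.1.1⟩, y.2.2.1.2, y.2.1⟩, by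
          have := y.2.2.2
          simp only [Set.mem_ofPred_eq, Prod.mk.injEq]
          omega⟩
        left_inv := fun _ => rfl
        right_inv := fun _ => rfl }
    rw [Nat.card_congr e, Nat.card_sigma]
    refine Finset.sum_congr rfl fun k _ => ?_
    rw [Nat.card_sigma, Finset.sum_range]
    exact Finset.sum_congr rfl fun a _ => (hf k).card_string _ _
  · intro k hk
    by_contra h
    refine hk (Finset.sum_eq_zero fun a _ => hK k ?_ _ _)
    simpa using h

namespace IsRSplitPMHSOn

variable {W : Type*} [AddCommGroup W] [Module ℂ W] {n : ℤ}
  {σ : W →ₛₗ[starRingEnd ℂ] W} {Q : W →ₗ[ℂ] W →ₗ[ℂ] ℂ} {I : ℤ → ℤ → Submodule ℂ W}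
  {N : W →ₗ[ℂ] W} {f : ℕ → ℤ → ℤ → ℕ} {hf : ∀ k : ℕ, IsHodgeDiamond (n + k) (f k)}
  {b : ∀ k : ℕ, StringTop (n + k) (f k) → ℕ → W}

theorem primitiveGrid_eq_zero_left (hb : ∀ k, IsPrimitiveStrings n σ Q I N k (hf k) (b k))
    (t : PrimitiveStringTop n f) (c a : ℕ) (hc : t.2.len < c) : primitiveGrid N b t c a = 0 := by
  rw [primitiveGrid, (hb t.1).eq_zero _ _ hc, map_zero]

theorem primitiveGrid_eq_zero_right (hb : ∀ k, IsPrimitiveStrings n σ Q I N k (hf k) (b k))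
    (t : PrimitiveStringTop n f) (c a : ℕ) (ha : t.1 < a) : primitiveGrid N b t c a = 0 :=
  pow_apply_eq_zero_of_le (pow_eq_zero_of_mem_primC ((hb t.1).mem _ _)) ha

theorem map_primitiveGrid (N : W →ₗ[ℂ] W) (b : ∀ k : ℕ, StringTop (n + k) (f k) → ℕ → W)
    (t : PrimitiveStringTop n f) (c a : ℕ) :
    N (primitiveGrid N b t c a) = primitiveGrid N b t c (a + 1) := by
  rw [primitiveGrid, primitiveGrid, pow_succ', Module.End.mul_apply]

theorem conj_primitiveGrid (h : IsRSplitPMHSOn n ⊤ σ Q I N)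
    (hb : ∀ k, IsPrimitiveStrings n σ Q I N k (hf k) (b k))
    (t : PrimitiveStringTop n f) (c a : ℕ) :
    σ (primitiveGrid N b t c a) = primitiveGrid N b (t.bar hf) c a := by
  rw [primitiveGrid, ← pow_comm_conj h.stable h.comm_conj _ _ Submodule.mem_top, (hb t.1).conj]
  rfl

theorem orth_primitiveGrid (h : IsRSplitPMHSOn n ⊤ σ Q I N)
    (hb : ∀ k, IsPrimitiveStrings n σ Q I N k (hf k) (b k))
    (t t' : PrimitiveStringTop n f) (c c' a a' : ℕ)
    (hne : ¬ (t' = t.bar hf ∧ c + c' = t.2.len ∧ a + a' = t.1)) :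
    Q (primitiveGrid N b t c a) (primitiveGrid N b t' c' a') = 0 := by
  obtain ⟨k, t⟩ := t
  obtain ⟨k', t'⟩ := t'
  by_cases hk : k = k' ∧ a + a' = k
  · obtain ⟨rfl, ha⟩ := hk
    simp only [primitiveGrid]
    rw [pow_skew h.stable h.skew a _ Submodule.mem_top _ Submodule.mem_top,
      ← Module.End.mul_apply, ← pow_add, ha, (hb k).orth _ _ _ _ fun h => hne ⟨?_, h.2, ha⟩,
      mul_zero]
    rw [h.1]
    rfl
  · exact h.orth_primC hk ((hb k).mem _ _) ((hb k').mem _ _)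

theorem pairing_primitiveGrid (h : IsRSplitPMHSOn n ⊤ σ Q I N)
    (hb : ∀ k, IsPrimitiveStrings n σ Q I N k (hf k) (b k))
    (t : PrimitiveStringTop n f) (c c' a a' : ℕ) (hc : c + c' = t.2.len) (ha : a + a' = t.1) :
    Q (primitiveGrid N b t c a) (primitiveGrid N b (t.bar hf) c' a') =
      (-1) ^ (a + c) * Complex.I ^ (t.2.right - t.2.left) := by
  simp only [primitiveGrid, PrimitiveStringTop.bar]
  rw [pow_skew h.stable h.skew a _ Submodule.mem_top _ Submodule.mem_top,
      ← Module.End.mul_apply, ← pow_add, ha, (hb t.1).pairing _ _ _ hc, pow_add, mul_assoc]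

theorem linearIndependent_primitiveGrid (h : IsRSplitPMHSOn n ⊤ σ Q I N)
    (hb : ∀ k, IsPrimitiveStrings n σ Q I N k (hf k) (b k)) :
    LinearIndependent ℂ fun x : GridIndex n f => primitiveGrid N b x.1 x.2.1 x.2.2 := by
  refine linearIndependent_of_biorthogonal _ (fun x => Q.flip
    (primitiveGrid N b (x.1.bar hf) (x.1.2.len - x.2.1) (x.1.1 - x.2.2))) (fun x y hxy => ?_)
    fun x => ?_
  · refine h.orth_primitiveGrid hb _ _ _ _ _ _ fun h => hxy ?_
    have h1 : y.1 = x.1 := (congrArg (PrimitiveStringTop.bar hf) h.1).symm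
    have h2 : y.1.2.len = x.1.2.len := by rw [h1]
    have h3 : y.1.1 = x.1.1 := by rw [h1]
    have := x.2.1.2
    have := x.2.2.2
    have := y.2.1.2
    have := y.2.2.2
    exact GridIndex.ext h1 (by omega) (by omega)
  · rw [LinearMap.flip_apply, h.pairing_primitiveGrid hb _ _ _ _ _ (by have := x.2.1.2; omega)
      (by have := x.2.2.2; omega)]
    exact mul_ne_zero (by simp) (zpow_ne_zero _ Complex.I_ne_zero)

/-- The span of the vectors of type `(p, q)` of a `primitiveGrid`. -/
def gridPart (N : W →ₗ[ℂ] W) (b : ∀ k : ℕ, StringTop (n + k) (f k) → ℕ → W) (p q : ℤ) :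
    Submodule ℂ W :=
  Submodule.span ℂ ((fun x : GridIndex n f => primitiveGrid N b x.1 x.2.1 x.2.2) ''
    {x | (x.1.2.left - (x.2.1 : ℕ) - (x.2.2 : ℕ),
      x.1.2.right - (x.2.1 : ℕ) - (x.2.2 : ℕ)) = (p, q)})

theorem finrank_gridPart (h : IsRSplitPMHSOn n ⊤ σ Q I N)
    (hb : ∀ k, IsPrimitiveStrings n σ Q I N k (hf k) (b k)) {K : ℕ}
    (hK : ∀ k, K ≤ k → ∀ p q, f k p q = 0) (p q : ℤ) :
    Module.finrank ℂ (gridPart N b p q) =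
      ∑ᶠ k : ℕ, ∑ a ∈ Finset.range (k + 1), f k (p + a) (q + a) := by
  have := PrimitiveStringTop.finite hf hK
  rw [gridPart, (h.linearIndependent_primitiveGrid hb).finrank_span_image,
    GridIndex.card_type hf hK]

variable [FiniteDimensional ℂ W]

theorem span_primitiveGrid (h : IsRSplitPMHSOn n ⊤ σ Q I N)
    (hb : ∀ k, IsPrimitiveStrings n σ Q I N k (hf k) (b k)) :
    ⊤ ≤ Submodule.span ℂ (Set.range fun x : GridIndex n f =>
      primitiveGrid N b x.1 x.2.1 x.2.2) := by
  have hmem : ∀ t c a, primitiveGrid N b t c a ∈ Submodule.span ℂ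
      (Set.range fun x : GridIndex n f => primitiveGrid N b x.1 x.2.1 x.2.2) := by
    intro t c a
    by_cases hc : t.2.len < c
    · rw [primitiveGrid_eq_zero_left hb _ _ _ hc]
      exact zero_mem _
    by_cases ha : t.1 < a
    · rw [primitiveGrid_eq_zero_right hb _ _ _ ha]
      exact zero_mem _
    exact Submodule.subset_span ⟨⟨t, ⟨c, by omega⟩, ⟨a, by omega⟩⟩, rfl⟩
  refine h.le_of_primC_le (fun v hv => ?_) fun k => ?_
  · refine Submodule.mem_comap.1 (Submodule.span_le.2 ?_ hv)
    rintro _ ⟨x, rfl⟩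
    simpa only [SetLike.mem_coe, Submodule.mem_comap, map_primitiveGrid] using hmem _ _ _
  · rw [← (hb k).span_eq, Submodule.span_le]
    rintro _ ⟨x, rfl⟩
    exact hmem ⟨k, x.1⟩ x.2 0

/-- The basis of `W` formed by the powers of `N` on the strings in the primitive subspaces. -/
noncomputable def gridBasis (h : IsRSplitPMHSOn n ⊤ σ Q I N)
    (hb : ∀ k, IsPrimitiveStrings n σ Q I N k (hf k) (b k)) :
    Module.Basis (GridIndex n f) ℂ W :=
  Module.Basis.mk (h.linearIndependent_primitiveGrid hb) (h.span_primitiveGrid hb)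

theorem gridBasis_apply (h : IsRSplitPMHSOn n ⊤ σ Q I N)
    (hb : ∀ k, IsPrimitiveStrings n σ Q I N k (hf k) (b k)) (x : GridIndex n f) :
    h.gridBasis hb x = primitiveGrid N b x.1 x.2.1 x.2.2 :=
  Module.Basis.mk_apply _ _ _

/-- The operator which shifts the strings in the primitive subspaces. -/
noncomputable def shift (h : IsRSplitPMHSOn n ⊤ σ Q I N)
    (hb : ∀ k, IsPrimitiveStrings n σ Q I N k (hf k) (b k)) : W →ₗ[ℂ] W :=
  (h.gridBasis hb).constr ℂ fun x => primitiveGrid N b x.1 (x.2.1 + 1) x.2.2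

variable (h : IsRSplitPMHSOn n ⊤ σ Q I N)
  (hb : ∀ k, IsPrimitiveStrings n σ Q I N k (hf k) (b k))

theorem shift_primitiveGrid (t : PrimitiveStringTop n f) (c a : ℕ) :
    h.shift hb (primitiveGrid N b t c a) = primitiveGrid N b t (c + 1) a := by
  by_cases hc : t.2.len < c
  · rw [primitiveGrid_eq_zero_left hb _ _ _ hc, primitiveGrid_eq_zero_left hb _ _ _ (by omega),
      map_zero]
  by_cases ha : t.1 < a
  · rw [primitiveGrid_eq_zero_right hb _ _ _ ha, primitiveGrid_eq_zero_right hb _ _ _ ha,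
      map_zero]
  have := (h.gridBasis hb).constr_basis ℂ
    (fun x => primitiveGrid N b x.1 (x.2.1 + 1) x.2.2) ⟨t, ⟨c, by omega⟩, ⟨a, by omega⟩⟩
  rwa [gridBasis_apply] at this

theorem shift_apply (k : ℕ) (t : StringTop (n + k) (f k)) (c : ℕ) :
    h.shift hb (b k t c) = b k t (c + 1) :=
  h.shift_primitiveGrid hb ⟨k, t⟩ c 0

theorem commute_shift : Commute N (h.shift hb) := by
  refine (h.gridBasis hb).ext fun x => ?_
  simp only [Module.End.mul_apply, gridBasis_apply, map_primitiveGrid, shift_primitiveGrid]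

theorem shift_comm_conj (v : W) : h.shift hb (σ v) = σ (h.shift hb v) := by
  have : (h.shift hb).comp σ = σ.comp (h.shift hb) := by
    refine (h.gridBasis hb).ext fun x => ?_
    simp only [LinearMap.comp_apply, gridBasis_apply, shift_primitiveGrid,
      h.conj_primitiveGrid hb]
  exact LinearMap.congr_fun this v

theorem shift_skew (u v : W) : Q (h.shift hb u) v + Q u (h.shift hb v) = 0 := by
  have key : ∀ t t' c c' a a', Q (primitiveGrid N b t (c + 1) a) (primitiveGrid N b t' c' a') +
      Q (primitiveGrid N b t c a) (primitiveGrid N b t' (c' + 1) a') = 0 := by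
    intro t t' c c' a a'
    by_cases ht : t' = t.bar hf ∧ c + 1 + c' = t.2.len ∧ a + a' = t.1
    · rw [ht.1, h.pairing_primitiveGrid hb _ _ _ _ _ ht.2.1 ht.2.2,
        h.pairing_primitiveGrid hb _ _ _ _ _ (by omega) ht.2.2]
      ring
    · rw [h.orth_primitiveGrid hb _ _ _ _ _ _ ht, h.orth_primitiveGrid hb, zero_add]
      rintro ⟨h1, h2, h3⟩
      exact ht ⟨h1, by omega, h3⟩
  have : Q.comp (h.shift hb) + Q.compl₂ (h.shift hb) = 0 := by
    refine LinearMap.ext_basis (h.gridBasis hb) (h.gridBasis hb) fun x y => ?_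
    simpa only [LinearMap.add_apply, LinearMap.comp_apply, LinearMap.compl₂_apply,
      gridBasis_apply, shift_primitiveGrid, LinearMap.zero_apply] using key _ _ _ _ _ _
  exact LinearMap.congr_fun₂ this u v

theorem shift_pow_primitiveGrid (m : ℕ) (t : PrimitiveStringTop n f) (c a : ℕ) :
    (h.shift hb ^ m) (primitiveGrid N b t c a) = primitiveGrid N b t (c + m) a := by
  induction m with
  | zero => simp
  | succ m ih => rw [pow_succ', Module.End.mul_apply, ih, shift_primitiveGrid, add_assoc]

theorem shift_nilpotent [Finite (PrimitiveStringTop n f)] : ∃ m : ℕ, h.shift hb ^ m = 0 := by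
  obtain ⟨m, hm⟩ := (Set.finite_range fun t : PrimitiveStringTop n f => t.2.len).bddAbove
  refine ⟨m + 1, (h.gridBasis hb).ext fun x => ?_⟩
  have := hm ⟨x.1, rfl⟩
  simp only at this
  rw [gridBasis_apply, shift_pow_primitiveGrid, primitiveGrid_eq_zero_left hb _ _ _ (by omega),
    LinearMap.zero_apply]

theorem shift_mem_map_realPrim {k a : ℕ} {u : W}
    (hu : u ∈ Submodule.map ((N ^ a).restrictScalars ℝ) (realPrim n σ I N k)) :
    h.shift hb u ∈ Submodule.map ((N ^ a).restrictScalars ℝ) (realPrim n σ I N k) := by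
  obtain ⟨w, ⟨hw, hσw⟩, rfl⟩ := hu
  refine ⟨h.shift hb w, ⟨(hb k).map_mem (h.shift_apply hb k) hw, ?_⟩, ?_⟩
  · rw [← shift_comm_conj, hσw]
  · exact LinearMap.congr_fun ((h.commute_shift hb).pow_left a).eq w

theorem isGridFamily [Fintype (PrimitiveStringTop n f)] :
    IsGridFamily n σ Q (gridPart N b) N (h.shift hb) (fun t : PrimitiveStringTop n f => t.1)
      (fun t => t.2.len) (fun t => t.2.left) (fun t => t.2.right) (PrimitiveStringTop.bar hf)
      (primitiveGrid N b) where
  weight t := t.2.left_add_right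
  bar_bar t := rfl
  P_bar t := rfl
  k_bar t := rfl
  eq_zero_left := primitiveGrid_eq_zero_left hb
  eq_zero_right := primitiveGrid_eq_zero_right hb
  commute := h.commute_shift hb
  map_right := map_primitiveGrid N b
  map_left := h.shift_primitiveGrid hb
  skew u v := by
    have h1 := h.skew u Submodule.mem_top v Submodule.mem_top
    have h2 := h.shift_skew hb u v
    simp only [LinearMap.add_apply, map_add]
    linear_combination h1 + h2
  comm_conj v := by
    rw [LinearMap.add_apply, LinearMap.add_apply, map_add, h.comm_conj v Submodule.mem_top,
      shift_comm_conj]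
  conj_b := h.conj_primitiveGrid hb
  indep := (h.linearIndependent_primitiveGrid hb).iSupIndep_span_image _
  mem_I t c a hc ha := Submodule.subset_span
    ⟨⟨t, ⟨c, Nat.lt_succ_of_le hc⟩, ⟨a, Nat.lt_succ_of_le ha⟩⟩, rfl, rfl⟩
  orth := h.orth_primitiveGrid hb
  pairing := h.pairing_primitiveGrid hb
  card := by
    rw [Module.finrank_eq_card_basis (h.gridBasis hb), Fintype.card_sigma]
    simp [mul_comm]

theorem isRSplitPMHSOn_add_shift [Finite (PrimitiveStringTop n f)] :
    IsRSplitPMHSOn n ⊤ σ Q (gridPart N b) (N + h.shift hb) := by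
  have := Fintype.ofFinite (PrimitiveStringTop n f)
  exact (h.isGridFamily hb).isStringFamily.isRSplitPMHSOn

end IsRSplitPMHSOn

/-- **Degenerating an ℝ-split PMHS along prescribed primitive diamonds (period
domains).**  Let `(I₁,N₁)` be an ℝ-split PMHS of weight `n` on `(V,Q)` (encoded via
`(W,σ,Q)`) with primitive Hodge–Deligne numbers `j^{p,q}`, and for each `k ≥ 0` let
`f_k` satisfy the Hodge diamond conditions for weight `n+k` and Hodge numbers
`(j^{p,n+k−p})_p`.  Then there is a real nilpotent `N'`, infinitesimally
`Q`-orthogonal, commuting with `N₁` and preserving each subspace `N₁^a(P_{n+k})`, and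
an ℝ-split PMHS `(I₂, N₁+N')` of weight `n` whose Hodge diamond is
`(p,q) ↦ Σ_{k≥0} Σ_{0≤a≤k} f_k(p+a, q+a)`; moreover `N'` can be chosen so that for
each `k` the induced pair on `(P_{n+k}, Q^{N₁}_k)` is an ℝ-split PMHS of weight `n+k`
with Hodge diamond `f_k`. -/
theorem stmt6 {W : Type*} [AddCommGroup W] [Module ℂ W] [FiniteDimensional ℂ W]
    (n : ℕ)
    (σ : W →ₛₗ[starRingEnd ℂ] W) (hσ : ∀ v, σ (σ v) = v)
    (Q : W →ₗ[ℂ] W →ₗ[ℂ] ℂ)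
    (hQreal : ∀ u v, Q (σ u) (σ v) = starRingEnd ℂ (Q u v))
    (hQnondeg : ∀ u, (∀ v, Q u v = 0) → u = 0)
    (hQsym : Even n → ∀ u v, Q u v = Q v u)
    (hQalt : Odd n → ∀ u v, Q u v = - Q v u)
    (I₁ : ℤ → ℤ → Submodule ℂ W) (N₁ : W →ₗ[ℂ] W)
    (hPMHS : IsRSplitPMHS (n : ℤ) σ Q I₁ N₁)
    (f : ℕ → ℤ → ℤ → ℕ)
    (hfa : ∀ k : ℕ, ∀ p : ℤ, ∃ s : Finset ℤ,
        (∀ q : ℤ, f k p q ≠ 0 → q ∈ s) ∧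
        ∑ q ∈ s, f k p q = primNum (n : ℤ) I₁ N₁ p ((n : ℤ) + k - p))
    (hfb : ∀ k : ℕ, ∀ p q : ℤ,
        f k p q = f k q p ∧ f k p q = f k ((n : ℤ) + k - q) ((n : ℤ) + k - p))
    (hfc : ∀ k : ℕ, ∀ p q : ℤ, p + q ≤ (n : ℤ) + k → f k (p - 1) (q - 1) ≤ f k p q) :
    ∃ (N' : W →ₗ[ℂ] W) (I₂ : ℤ → ℤ → Submodule ℂ W) (J : ℕ → ℤ → ℤ → Submodule ℂ W),
      (∃ m : ℕ, N' ^ m = 0) ∧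
      (∀ u v, Q (N' u) v + Q u (N' v) = 0) ∧
      (∀ v, N' (σ v) = σ (N' v)) ∧
      (∀ v, N' (N₁ v) = N₁ (N' v)) ∧
      (∀ k a : ℕ, a ≤ k →
        ∀ u ∈ Submodule.map ((N₁ ^ a).restrictScalars ℝ) (realPrim (n : ℤ) σ I₁ N₁ k),
          N' u ∈ Submodule.map ((N₁ ^ a).restrictScalars ℝ) (realPrim (n : ℤ) σ I₁ N₁ k)) ∧
      IsRSplitPMHS (n : ℤ) σ Q I₂ (N₁ + N') ∧
      (∀ p q : ℤ, Module.finrank ℂ (I₂ p q) =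
        ∑ᶠ k : ℕ, ∑ a ∈ Finset.range (k + 1), f k (p + a) (q + a)) ∧
      (∀ k : ℕ,
        IsRSplitPMHSOn ((n : ℤ) + k) (primC (n : ℤ) I₁ N₁ k) σ
          (Q.compl₂ (N₁ ^ k)) (J k) N' ∧
        ∀ p q : ℤ, Module.finrank ℂ (J k p q) = f k p q) := by
  have hsymm : ∀ u v, Q u v = (-1) ^ n * Q v u := fun u v => by
    rcases Nat.even_or_odd n with hn | hn
    · rw [hn.neg_one_pow, one_mul, hQsym hn]
    · rw [hn.neg_one_pow, neg_one_mul, hQalt hn]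
  have h : IsRSplitPMHSOn n ⊤ σ Q I₁ N₁ := hPMHS
  have hf : ∀ k : ℕ, IsHodgeDiamond (n + k) (f k) := fun k =>
    h.isHodgeDiamond (hfa k) (hfb k) (hfc k)
  choose b hb using fun k => h.exists_strings_primC hσ hQreal hsymm (hf k) (hfa k)
  obtain ⟨K, hK⟩ := h.1
  have hf0 : ∀ k, K ≤ k → ∀ p q, f k p q = 0 := fun k hk p q => by
    have hle : IsPrimitiveStrings.part (b k) p q ≤ primC n I₁ N₁ k :=
      Submodule.span_le.2 fun v ⟨x, _, hx⟩ => hx ▸ (hb k).mem _ _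
    rw [h.primC_eq_bot hK hk, le_bot_iff] at hle
    rw [← (hb k).finrank_part, hle, finrank_bot]
  have := PrimitiveStringTop.finite hf hf0
  exact ⟨h.shift hb, IsRSplitPMHSOn.gridPart N₁ b, fun k => IsPrimitiveStrings.part (b k),
    h.shift_nilpotent hb, h.shift_skew hb, h.shift_comm_conj hb,
    fun v => (LinearMap.congr_fun (h.commute_shift hb).eq v).symm,
    fun k a _ u hu => h.shift_mem_map_realPrim hb hu, h.isRSplitPMHSOn_add_shift hb,
    h.finrank_gridPart hb hf0, fun k => ⟨(hb k).isRSplitPMHSOn h (h.shift_apply hb k)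
      (h.shift_skew hb) (h.shift_comm_conj hb) (h.commute_shift hb), (hb k).finrank_part⟩⟩
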